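/- Let G be a finite normal-form game with N ≥ 2 players, and set κ = Σ_n |S_n|, d = N−1, Z = (2d+6)(2d+5)^{κ−1}, D = 5(κ(2d+4)+2)·Z, ℒ = d·(6d−3)^{2κ−1}, ℓ = 2d(ZD)^2(1+Z) and K = ℒ·ℓ. Then a mixed-strategy profile σ ∈ Σ is a perfect equilibrium of G if and only if there exists an LPS profile ϱ of order K over S such that: (1) ϱ has full support and ℓ(ϱ) ≤ ℓ; (2) ϱ_n^0 = σ_n for each player n; (3) σ_n is a best reply of order ℓ(ϱ)·ℒ against ϱ for each player n. -/

import Mathlib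

namespace GamePE

variable {N : ℕ}

/-- A (not necessarily mixed) strategy profile. -/
abbrev Profile (S : Fin N → Type) := ∀ n, S n → ℝ

/-- τ is a profile of mixed strategies. -/
def IsMixed {S : Fin N → Type} [∀ n, Fintype (S n)] (τ : Profile S) : Prop :=
  ∀ n, (∀ s, 0 ≤ τ n s) ∧ (∑ s, τ n s) = 1

/-- τ is completely mixed. -/
def CompletelyMixed {S : Fin N → Type} (τ : Profile S) : Prop := ∀ n s, 0 < τ n s

/-- The pure strategy sn viewed as a mixed strategy. -/
def pureStrat {S : Fin N → Type} [∀ n, DecidableEq (S n)] {n : Fin N} (sn : S n) : S n → ℝ :=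
  fun s => if s = sn then 1 else 0

/-- The multilinear extension of player n's payoff. -/
noncomputable def payoff {S : Fin N → Type} [∀ n, Fintype (S n)]
    (G : Fin N → (∀ m, S m) → ℝ) (n : Fin N) (τ : Profile S) : ℝ :=
  ∑ s : ∀ m, S m, (∏ m, τ m (s m)) * G n s

/-- σ is a perfect equilibrium of the game G. -/
noncomputable def IsPerfect {S : Fin N → Type} [∀ n, Fintype (S n)] [∀ n, DecidableEq (S n)]
    (G : Fin N → (∀ m, S m) → ℝ) (σ : Profile S) : Prop :=
  ∃ σk : ℕ → Profile S,
    (∀ k, IsMixed (σk k) ∧ CompletelyMixed (σk k)) ∧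
    Filter.Tendsto σk Filter.atTop (nhds σ) ∧
    (∀ (k : ℕ) (n : Fin N) (sn : S n),
      payoff G n (Function.update (σk k) n (σ n)) ≥
        payoff G n (Function.update (σk k) n (pureStrat sn)))

/-- ϱ is an LPS profile of order K : each level of each player is a probability distribution. -/
def IsLPSProfile {S : Fin N → Type} [∀ n, Fintype (S n)] {K : ℕ}
    (ϱ : ∀ n, Fin (K+1) → S n → ℝ) : Prop :=
  ∀ n k, (∀ s, 0 ≤ ϱ n k s) ∧ (∑ s, ϱ n k s) = 1

/-- Full support for an LPS profile. -/
def FullSupport {S : Fin N → Type} {K : ℕ} (ϱ : ∀ n, Fin (K+1) → S n → ℝ) : Prop :=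
  ∀ n, ∀ s : S n, ∃ k, ϱ n k s ≠ 0

/-- ℓ(ϱ) : the max over the players of the first level at which the union of supports is everything. -/
noncomputable def lpsLevel {S : Fin N → Type} [∀ n, Fintype (S n)] {K : ℕ}
    (ϱ : ∀ n, Fin (K+1) → S n → ℝ) : ℕ :=
  Finset.univ.sup fun n =>
    sInf {k : ℕ | ∀ s : S n, ∃ i : Fin (K+1), (i : ℕ) ≤ k ∧ ϱ n i s ≠ 0}

/-- Combine a pure strategy of player n with a pure strategy profile of the others. -/
def combine {S : Fin N → Type} (n : Fin N) (sn : S n)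
    (so : ∀ m : {m : Fin N // m ≠ n}, S m.val) : ∀ m, S m :=
  fun m => if h : m = n then cast (congrArg S h.symm) sn else so ⟨m, h⟩

/-- Unnormalized induced beliefs of player n at level k. -/
noncomputable def ubelief {S : Fin N → Type} [∀ n, Fintype (S n)] {K : ℕ}
    (ϱ : ∀ n, Fin (K+1) → S n → ℝ) (n : Fin N) (k : ℕ)
    (so : ∀ m : {m : Fin N // m ≠ n}, S m.val) : ℝ :=
  ∑ kv ∈ Finset.univ.filter
      (fun kv : {m : Fin N // m ≠ n} → Fin (K+1) => (∑ m, ((kv m : ℕ))) = k),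
    ∏ m : {m : Fin N // m ≠ n}, ϱ m.val (kv m) (so m)

/-- Induced beliefs μ_n^k of player n at level k (normalized). -/
noncomputable def belief {S : Fin N → Type} [∀ n, Fintype (S n)] {K : ℕ}
    (ϱ : ∀ n, Fin (K+1) → S n → ℝ) (n : Fin N) (k : ℕ)
    (so : ∀ m : {m : Fin N // m ≠ n}, S m.val) : ℝ :=
  (∑ so' : ∀ m : {m : Fin N // m ≠ n}, S m.val, ubelief ϱ n k so')⁻¹ * ubelief ϱ n k so

/-- Expected payoff of player n playing τn against a belief μ over the opponents' profiles. -/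
noncomputable def beliefPayoff {S : Fin N → Type} [∀ n, Fintype (S n)]
    (G : Fin N → (∀ m, S m) → ℝ) (n : Fin N) (τn : S n → ℝ)
    (μ : (∀ m : {m : Fin N // m ≠ n}, S m.val) → ℝ) : ℝ :=
  ∑ so : ∀ m : {m : Fin N // m ≠ n}, S m.val, ∑ sn : S n,
    μ so * τn sn * G n (combine n sn so)

/-- Lexicographic comparison of the first k+1 entries (indices 0,…,k) of two sequences. -/
def lexGe (k : ℕ) (a b : ℕ → ℝ) : Prop :=
  (∀ i ≤ k, a i = b i) ∨ ∃ i ≤ k, (∀ j < i, a j = b j) ∧ b i < a i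

/-- τn is a best reply of order k against the LPS profile ϱ. -/
noncomputable def lpsBestReply {S : Fin N → Type} [∀ n, Fintype (S n)] [∀ n, DecidableEq (S n)]
    (G : Fin N → (∀ m, S m) → ℝ) {K : ℕ} (ϱ : ∀ n, Fin (K+1) → S n → ℝ)
    (n : Fin N) (τn : S n → ℝ) (k : ℕ) : Prop :=
  ∀ sn : S n,
    lexGe k (fun i => beliefPayoff G n τn (belief ϱ n i))
            (fun i => beliefPayoff G n (pureStrat sn) (belief ϱ n i))

/-- A polynomial strategy profile. -/
abbrev PolyProfile (S : Fin N → Type) := ∀ n, S n → Polynomial ℝ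

/-- f > 0 for a univariate real polynomial: the trailing (lowest-order) coefficient is positive. -/
def polyPos (f : Polynomial ℝ) : Prop := 0 < f.trailingCoeff

/-- f ≥ 0 : f is identically zero or its trailing coefficient is positive. -/
def polyNonneg (f : Polynomial ℝ) : Prop := f = 0 ∨ 0 < f.trailingCoeff

/-- The order o(η) of a polynomial strategy profile (∞ if some coordinate is zero). -/
noncomputable def polyOrder {S : Fin N → Type} [∀ n, Fintype (S n)]
    (η : PolyProfile S) : ℕ∞ :=
  Finset.univ.sup fun p : Σ n, S n => (η p.1 p.2).trailingDegree

/-- The polynomial t ↦ G_n(τn, η_{-n}(t)). -/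
noncomputable def payoffPoly {S : Fin N → Type} [∀ n, Fintype (S n)]
    (G : Fin N → (∀ m, S m) → ℝ) (η : PolyProfile S) (n : Fin N) (τn : S n → ℝ) :
    Polynomial ℝ :=
  ∑ s : ∀ m, S m,
    (Polynomial.C (τn (s n)) * ∏ m ∈ Finset.univ.erase n, η m (s m)) * Polynomial.C (G n s)

/-- τn is a best reply of order r against the polynomial strategy profile η. -/
noncomputable def polyBestReply {S : Fin N → Type} [∀ n, Fintype (S n)] [∀ n, DecidableEq (S n)]
    (G : Fin N → (∀ m, S m) → ℝ) (η : PolyProfile S) (n : Fin N) (τn : S n → ℝ) (r : ℕ) : Prop :=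
  ∀ sn : S n,
    polyNonneg (payoffPoly G η n τn - payoffPoly G η n (pureStrat sn)) ∨
    ((r + 1 : ℕ) : ℕ∞) ≤ (payoffPoly G η n τn - payoffPoly G η n (pureStrat sn)).trailingDegree

open MvPolynomial in
/-- On the common zeros of `X_i ^ e = h_i` with `deg h_i < e`, more than `(m+1) * e ^ |ι|`
polynomials of degree at most `m` are linearly dependent. -/
theorem exists_relation_on_zeros {ι J : Type*} [Fintype ι] [Fintype J] (e : ℕ)
    (h : ι → MvPolynomial (Option ι) ℝ) (hh : ∀ i, (h i).totalDegree < e) (m : ℕ)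
    (g : J → MvPolynomial (Option ι) ℝ) (hg : ∀ j, (g j).totalDegree ≤ m)
    (hJ : (m + 1) * e ^ Fintype.card ι < Fintype.card J) :
    ∃ a : J → ℝ, a ≠ 0 ∧ ∀ p : Option ι → ℝ, (∀ i, p (some i) ^ e = eval p (h i)) →
      ∑ j, a j * eval p (g j) = 0 := by
  classical
  let Sol := {p : Option ι → ℝ // ∀ i, p (some i) ^ e = eval p (h i)}
  let ev : MvPolynomial (Option ι) ℝ →ₗ[ℝ] (Sol → ℝ) :=
    LinearMap.pi fun p => (aeval p.1 : MvPolynomial (Option ι) ℝ →ₐ[ℝ] ℝ).toLinearMap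
  have hev : ∀ q p, ev q p = eval p.1 q := fun q p => by
    simp [ev, aeval_eq_eval]
  let w : Fin (m + 1) × (ι → Fin e) → (Sol → ℝ) := fun x p =>
    p.1 none ^ (x.1 : ℕ) * ∏ i, p.1 (some i) ^ (x.2 i : ℕ)
  let W := Submodule.span ℝ (Set.range w)
  have key : ∀ n ≤ m, ∀ q : MvPolynomial (Option ι) ℝ, q.totalDegree ≤ n → ev q ∈ W := by
    intro n
    induction n using Nat.strong_induction_on with
    | _ n ih =>
      intro hn q hq
      rw [q.as_sum, map_sum]
      refine Submodule.sum_mem _ fun s hs => ?_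
      have hsn : (s.sum fun _ k => k) ≤ n := (le_totalDegree hs).trans hq
      rw [← mul_one (coeff s q), ← smul_eq_mul, ← smul_monomial, map_smul]
      refine Submodule.smul_mem _ _ ?_
      by_cases hlt : ∀ i, s (some i) < e
      · have hs0 : s none ≤ m := by
          refine le_trans ?_ (hsn.trans hn)
          by_cases h0 : s none = 0
          · simp [h0]
          · exact Finset.single_le_sum (f := fun a => s a) (fun _ _ => Nat.zero_le _)
              (Finsupp.mem_support_iff.2 h0)
        refine Submodule.subset_span ⟨(⟨s none, by omega⟩, fun i => ⟨s (some i), hlt i⟩), ?_⟩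
        funext p
        rw [hev, eval_monomial, one_mul, Finsupp.prod_fintype _ _ (by simp), Fintype.prod_option]
      · push Not at hlt
        obtain ⟨i, hi⟩ := hlt
        set s' := s - Finsupp.single (some i) e with hs'
        have hss : s = Finsupp.single (some i) e + s' := by
          ext a
          by_cases ha : a = some i
          · subst ha; simp [hs']; omega
          · simp [hs', Ne.symm ha]
        have hdeg : (s.sum fun _ k => k) = e + (s'.sum fun _ k => k) := by
          conv_lhs => rw [hss]
          rw [Finsupp.sum_add_index' (by simp) (by simp), Finsupp.sum_single_index rfl]
        have heq : ev (monomial s 1) = ev (h i * monomial s' 1) := by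
          funext p
          rw [hev, hev, map_mul, ← p.2 i]
          conv_lhs => rw [hss, ← mul_one (1 : ℝ), ← monomial_mul, map_mul]
          simp [eval_monomial]
        rw [heq]
        have hd : (h i * monomial s' (1 : ℝ)).totalDegree ≤
            (h i).totalDegree + (s'.sum fun _ k => k) := by
          refine (totalDegree_mul _ _).trans ?_
          gcongr
          exact totalDegree_monomial_le _ _
        have := hh i
        exact ih (n - 1) (by omega) (by omega) _ (by omega)
  have hnot : ¬ LinearIndependent ℝ (fun j => (⟨ev (g j), key m le_rfl _ (hg j)⟩ : W)) := by
    intro hli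
    have : Module.Finite ℝ W := FiniteDimensional.span_of_finite ℝ (Set.finite_range w)
    have h1 := hli.fintype_card_le_finrank
    have h2 : Module.finrank ℝ W ≤ _ := finrank_range_le_card (R := ℝ) w
    simp only [Fintype.card_prod, Fintype.card_fin, Fintype.card_pi, Finset.prod_const,
      Finset.card_univ] at h2
    omega
  rw [Fintype.not_linearIndependent_iff] at hnot
  obtain ⟨a, ha, j, hj⟩ := hnot
  refine ⟨a, fun h0 => hj (by simp [h0]), fun p hp => ?_⟩
  have := congrFun (congrArg Subtype.val ha) ⟨p, hp⟩
  simpa [hev] using this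

open MvPolynomial in
theorem hasDerivAt_eval_update {τ : Type*} [DecidableEq τ] (q : MvPolynomial τ ℝ) (p : τ → ℝ)
    (i : τ) (t : ℝ) :
    HasDerivAt (fun s => eval (Function.update p i s) q)
      (eval (Function.update p i t) (pderiv i q)) t := by
  induction q using MvPolynomial.induction_on with
  | C a => simpa using hasDerivAt_const t a
  | add f g hf hg => simp only [map_add]; exact hf.add hg
  | mul_X f j hf =>
    have hX : HasDerivAt (fun s => Function.update p i s j)
        (eval (Function.update p i t) (pderiv i (X j))) t := by
      by_cases hj : j = i
      · subst hj; simp only [Function.update_self, pderiv_X_self, map_one]; exact hasDerivAt_id t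
      · simpa [hj, pderiv_X_of_ne (Ne.symm hj), pderiv_X_of_ne hj] using hasDerivAt_const t (p j)
    simp only [map_mul, eval_X, Derivation.leibniz, smul_eq_mul, map_add]
    exact (hf.fun_mul hX).congr_deriv (by ring)

theorem hasDerivAt_min_zero_sq (u : ℝ) : HasDerivAt (fun s : ℝ => min s 0 ^ 2) (2 * min u 0) u := by
  rcases lt_trichotomy u 0 with h | h | h
  · have h1 : HasDerivAt (fun s : ℝ => s ^ 2) (2 * u) u := by simpa using hasDerivAt_pow 2 u
    rw [min_eq_left h.le]
    refine h1.congr_of_eventuallyEq ?_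
    filter_upwards [Iio_mem_nhds h] with s hs
    rw [min_eq_left (le_of_lt hs)]
  · subst h
    rw [hasDerivAt_iff_isLittleO]
    simp only [min_self, mul_zero, smul_zero, sub_zero, ne_eq, OfNat.ofNat_ne_zero,
      not_false_eq_true, zero_pow]
    have h2 : (fun s : ℝ => s ^ 2) =o[nhds 0] fun s => s := by
      simpa using Asymptotics.isLittleO_pow_id (𝕜 := ℝ) (n := 2) (by norm_num)
    refine Asymptotics.IsBigO.trans_isLittleO ?_ h2
    refine Asymptotics.isBigO_of_le _ fun s => ?_
    rw [norm_pow, norm_pow]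
    gcongr
    rcases le_total s 0 with hs | hs <;> simp [hs]
  · rw [min_eq_right h.le, mul_zero]
    refine (hasDerivAt_const u (0 : ℝ)).congr_of_eventuallyEq ?_
    filter_upwards [Ioi_mem_nhds h] with s hs
    simp [min_eq_right (le_of_lt (Set.mem_Ioi.1 hs))]

section Minimizers

variable {ι Γ : Type*}

/-- The point with parameter coordinate `ε` and remaining coordinates `x`. -/
def paramPoint (ε : ℝ) (x : ι → ℝ) : Option ι → ℝ := fun o => o.elim ε x

theorem continuous_eval_paramPoint (p : MvPolynomial (Option ι) ℝ) (ε : ℝ) :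
    Continuous fun x : ι → ℝ => MvPolynomial.eval (paramPoint ε x) p := by
  refine (MvPolynomial.continuous_eval p).comp ?_
  refine continuous_pi fun o => ?_
  cases o with
  | none => exact continuous_const
  | some i => exact continuous_apply i

open MvPolynomial in
/-- The right-hand side of the critical point equations of `regPenalty`. -/
noncomputable def criticalRhs (q : Γ → MvPolynomial (Option ι) ℝ) (σ : ι → ℝ) (d : ℕ) (lam : ℝ)
    (B : Finset Γ) (i : ι) : MvPolynomial (Option ι) ℝ :=
  C (-(lam ^ 2 * (2 * d + 2))⁻¹) * (∑ c ∈ B, C 2 * (q c * pderiv (some i) (q c)) +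
    C (2 * lam) * (X (some i) - C (σ i)))

open MvPolynomial in
theorem totalDegree_pderiv_le' {τ : Type*} (i : τ) (p : MvPolynomial τ ℝ) :
    (pderiv i p).totalDegree ≤ p.totalDegree := by
  classical
  rw [p.as_sum, map_sum]
  refine (totalDegree_finsetSum _ _).trans (Finset.sup_le fun s hs => ?_)
  rw [pderiv_monomial, ← p.as_sum]
  refine (totalDegree_monomial_le _ _).trans (le_trans ?_ (le_totalDegree hs))
  exact Finsupp.degree_mono tsub_le_self

open MvPolynomial in
theorem totalDegree_criticalRhs_lt (q : Γ → MvPolynomial (Option ι) ℝ) (σ : ι → ℝ) {d : ℕ}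
    (hd : 1 ≤ d) (hq : ∀ c, (q c).totalDegree ≤ d) (lam : ℝ) (B : Finset Γ) (i : ι) :
    (criticalRhs q σ d lam B i).totalDegree < 2 * d + 1 := by
  have hmulC : ∀ (a : ℝ) (p : MvPolynomial (Option ι) ℝ), (C a * p).totalDegree ≤ p.totalDegree :=
    fun a p => (totalDegree_mul _ _).trans (by simp)
  refine Nat.lt_succ_of_le ((hmulC _ _).trans ((totalDegree_add _ _).trans (max_le ?_ ?_)))
  · refine (totalDegree_finsetSum _ _).trans (Finset.sup_le fun c _ => ?_)
    refine (hmulC _ _).trans ((totalDegree_mul _ _).trans ?_)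
    have := totalDegree_pderiv_le' (some i) (q c)
    have := hq c
    omega
  · refine (hmulC _ _).trans ((totalDegree_sub _ _).trans (max_le ?_ ?_))
    · rw [totalDegree_X]; omega
    · simp

variable [Fintype Γ]

/-- Quadratic penalty for the violation of the constraints `0 ≤ q c`. -/
noncomputable def penalty (q : Γ → MvPolynomial (Option ι) ℝ) (ε : ℝ) (x : ι → ℝ) : ℝ :=
  ∑ c, min (MvPolynomial.eval (paramPoint ε x) (q c)) 0 ^ 2

theorem penalty_nonneg (q : Γ → MvPolynomial (Option ι) ℝ) (ε : ℝ) (x : ι → ℝ) :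
    0 ≤ penalty q ε x := Finset.sum_nonneg fun _ _ => sq_nonneg _

theorem penalty_eq_zero_iff {q : Γ → MvPolynomial (Option ι) ℝ} {ε : ℝ} {x : ι → ℝ} :
    penalty q ε x = 0 ↔ ∀ c, 0 ≤ MvPolynomial.eval (paramPoint ε x) (q c) := by
  rw [penalty, Finset.sum_eq_zero_iff_of_nonneg fun _ _ => sq_nonneg _]
  simp

/-- Violated constraints at a point. -/
noncomputable def violated (q : Γ → MvPolynomial (Option ι) ℝ) (ε : ℝ) (x : ι → ℝ) : Finset Γ :=
  by classical exact Finset.univ.filter fun c => MvPolynomial.eval (paramPoint ε x) (q c) < 0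

theorem continuous_penalty (q : Γ → MvPolynomial (Option ι) ℝ) (ε : ℝ) :
    Continuous (penalty q ε) := by
  unfold penalty
  have := fun c => continuous_eval_paramPoint (q c) ε
  fun_prop

theorem penalty_eq_sum_violated (q : Γ → MvPolynomial (Option ι) ℝ) (ε : ℝ) (x : ι → ℝ) :
    penalty q ε x = ∑ c ∈ violated q ε x, MvPolynomial.eval (paramPoint ε x) (q c) ^ 2 := by
  classical
  rw [penalty, violated, Finset.sum_filter]
  refine Finset.sum_congr rfl fun c _ => ?_
  split_ifs with h
  · rw [min_eq_left h.le]
  · rw [min_eq_right (not_lt.1 h)]; simp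

variable [Fintype ι]

/-- The penalty, regularized by terms that make its critical points algebraic. -/
noncomputable def regPenalty (q : Γ → MvPolynomial (Option ι) ℝ) (σ : ι → ℝ) (d : ℕ) (lam ε : ℝ)
    (x : ι → ℝ) : ℝ :=
  penalty q ε x + lam * ∑ i, (x i - σ i) ^ 2 + lam ^ 2 * ∑ i, x i ^ (2 * d + 2)

theorem penalty_le_regPenalty (q : Γ → MvPolynomial (Option ι) ℝ) (σ : ι → ℝ) (d : ℕ) (lam ε : ℝ)
    (x : ι → ℝ) :
    penalty q ε x + lam * ∑ i, (x i - σ i) ^ 2 ≤ regPenalty q σ d lam ε x := by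
  have h2 : 0 ≤ ∑ i, x i ^ (2 * d + 2) :=
    Finset.sum_nonneg fun _ _ => (Even.pow_nonneg ⟨d + 1, by ring⟩ _)
  have := mul_nonneg (sq_nonneg lam) h2
  unfold regPenalty
  linarith

theorem exists_regPenalty_minimizer (q : Γ → MvPolynomial (Option ι) ℝ) (σ : ι → ℝ) (d : ℕ)
    {lam : ℝ} (hl : 0 ≤ lam) (ε : ℝ)
    (hco : ∀ M, ∃ R, ∀ x, penalty q ε x ≤ M → ‖x‖ ≤ R) :
    ∃ x, ∀ y, regPenalty q σ d lam ε x ≤ regPenalty q σ d lam ε y := by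
  have hcont : Continuous (regPenalty q σ d lam ε) := by
    unfold regPenalty
    have := continuous_penalty q ε
    fun_prop
  obtain ⟨R, hR⟩ := hco (regPenalty q σ d lam ε σ)
  refine hcont.exists_forall_le' σ ?_
  filter_upwards [(isCompact_closedBall (0 : ι → ℝ) R).compl_mem_cocompact] with x hx
  by_contra! hlt
  apply hx
  rw [mem_closedBall_zero_iff]
  refine hR x ?_
  have h1 := penalty_le_regPenalty q σ d lam ε x
  have h2 : 0 ≤ lam * ∑ i, (x i - σ i) ^ 2 :=
    mul_nonneg hl (Finset.sum_nonneg fun _ _ => sq_nonneg _)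
  linarith

open MvPolynomial in
theorem regPenalty_minimizer_critical (q : Γ → MvPolynomial (Option ι) ℝ) (σ : ι → ℝ) (d : ℕ)
    {lam : ℝ} (hl : 0 < lam) (ε : ℝ) {x : ι → ℝ}
    (hx : ∀ y, regPenalty q σ d lam ε x ≤ regPenalty q σ d lam ε y) (i : ι) :
    x i ^ (2 * d + 1) =
      eval (paramPoint ε x) (criticalRhs q σ d lam (violated q ε x) i) := by
  classical
  have hpt : ∀ s, paramPoint ε (Function.update x i s) =
      Function.update (paramPoint ε x) (some i) s := by
    intro s
    funext o
    cases o with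
    | none => simp [paramPoint]
    | some j => by_cases hj : j = i
                · subst hj; simp [paramPoint]
                · simp [paramPoint, hj]
  have hself : Function.update (paramPoint ε x) (some i) (x i) = paramPoint ε x := by
    rw [← hpt]; simp
  have hpen : HasDerivAt (fun s => penalty q ε (Function.update x i s))
      (∑ c, 2 * min (eval (paramPoint ε x) (q c)) 0 *
        eval (paramPoint ε x) (pderiv (some i) (q c))) (x i) := by
    unfold penalty
    refine HasDerivAt.fun_sum fun c _ => ?_
    simp_rw [hpt]
    have h1 := hasDerivAt_eval_update (q c) (paramPoint ε x) (some i) (x i)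
    rw [hself] at h1
    refine HasDerivAt.comp (h₂ := fun u : ℝ => min u 0 ^ 2) (x i) ?_ h1
    rw [hself]
    exact hasDerivAt_min_zero_sq _
  have hcoord : ∀ (f f' : ι → ℝ → ℝ), (∀ j u, HasDerivAt (f j) (f' j u) u) →
      HasDerivAt (fun s => ∑ j, f j (Function.update x i s j)) (f' i (x i)) (x i) := by
    intro f f' hf
    have : f' i (x i) = ∑ j, if j = i then f' i (x i) else 0 := by simp
    rw [this]
    refine HasDerivAt.fun_sum fun j _ => ?_
    by_cases hj : j = i
    · subst hj; simpa using hf j (x j)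
    · simpa [hj] using hasDerivAt_const (x i) (f j (x j))
  have h2 := hcoord (fun j s => (s - σ j) ^ 2) (fun j u => 2 * (u - σ j)) (fun j u => by
    simpa using ((hasDerivAt_id u).sub_const (σ j)).fun_pow 2)
  have h3 := hcoord (fun j s => s ^ (2 * d + 2)) (fun j u => (2 * d + 2) * u ^ (2 * d + 1))
    (fun j u => by simpa using hasDerivAt_pow (2 * d + 2) u)
  have htot := (hpen.add (h2.const_mul lam)).add (h3.const_mul (lam ^ 2))
  have hmin : IsLocalMin (fun s => regPenalty q σ d lam ε (Function.update x i s)) (x i) := by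
    refine Filter.Eventually.of_forall fun s => ?_
    simpa using hx (Function.update x i s)
  have hzero := hmin.hasDerivAt_eq_zero htot
  have hsum : ∑ c, 2 * min (eval (paramPoint ε x) (q c)) 0 *
        eval (paramPoint ε x) (pderiv (some i) (q c)) =
      ∑ c ∈ violated q ε x, 2 * (eval (paramPoint ε x) (q c) *
        eval (paramPoint ε x) (pderiv (some i) (q c))) := by
    rw [violated, Finset.sum_filter]
    refine Finset.sum_congr rfl fun c _ => ?_
    split_ifs with h
    · rw [min_eq_left h.le]; ring
    · rw [min_eq_right (not_lt.1 h)]; simp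
  rw [hsum] at hzero
  have hd : (2 * (d : ℝ) + 2) ≠ 0 := by positivity
  simp only [criticalRhs, map_mul, map_add, map_sum, map_sub, eval_C, eval_X]
  have hpx : paramPoint ε x (some i) = x i := rfl
  rw [hpx]
  set A := ∑ c ∈ violated q ε x, 2 * (eval (paramPoint ε x) (q c) *
        eval (paramPoint ε x) (pderiv (some i) (q c)))
  have hl' := hl.ne'
  field_simp
  linear_combination hzero

end Minimizers

section Ultralimits

open Filter Topology

theorem exists_ultralimit {E : Type*} [SeminormedAddCommGroup E] [ProperSpace E]
    (U : Ultrafilter ℕ) (f : ℕ → E) (R : ℝ) (hf : ∀ k, ‖f k‖ ≤ R) : ∃ z, Tendsto f U (𝓝 z) := by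
  obtain ⟨z, -, hz⟩ := (isCompact_closedBall (0 : E) R).ultrafilter_le_nhds (U.map f)
    (le_principal_iff.2 (mem_map.2 (univ_mem' fun k => by simpa using hf k)))
  exact ⟨z, hz⟩

theorem exists_ultraconstant {α : Type*} [Finite α] (U : Ultrafilter ℕ) (f : ℕ → α) :
    ∃ a, ∀ᶠ k in U, f k = a := by
  obtain ⟨a, ha⟩ := (U.map f).eq_pure_of_finite
  refine ⟨a, ?_⟩
  have : {a} ∈ U.map f := by rw [ha]; simp
  exact this

variable {ι Γ : Type*} [Fintype ι] [Fintype Γ]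

/-- Coercive penalties have minimizers which, on each of finitely many pieces of the parameter
space, satisfy as many linear relations between polynomials as solutions of a nondegenerate
algebraic system. -/
theorem exists_algebraic_minimizers (q : Γ → MvPolynomial (Option ι) ℝ) (σ : ι → ℝ) {d : ℕ}
    (hd : 1 ≤ d) (hq : ∀ c, (q c).totalDegree ≤ d)
    (hco : ∀ ε M, ∃ R, ∀ x, penalty q ε x ≤ M → ‖x‖ ≤ R) :
    ∃ (z : ℝ → ι → ℝ) (b : ℝ → Finset Γ),
      (∀ ε x, penalty q ε (z ε) ≤ penalty q ε x) ∧
      (∀ ε x, penalty q ε x = 0 → ∑ i, (z ε i - σ i) ^ 2 ≤ ∑ i, (x i - σ i) ^ 2) ∧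
      (∀ ε, penalty q ε (z ε) = ∑ c ∈ b ε, MvPolynomial.eval (paramPoint ε (z ε)) (q c) ^ 2) ∧
      ∀ (B : Finset Γ) (m : ℕ) (J : Type) [Fintype J] (g : J → MvPolynomial (Option ι) ℝ),
        (∀ j, (g j).totalDegree ≤ m) →
        (m + 1) * (2 * d + 1) ^ Fintype.card ι < Fintype.card J →
        ∃ a : J → ℝ, a ≠ 0 ∧
          ∀ ε, b ε = B → ∑ j, a j * MvPolynomial.eval (paramPoint ε (z ε)) (g j) = 0 := by
  classical
  set U : Ultrafilter ℕ := hyperfilter ℕ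
  have hU : (U : Filter ℕ) ≤ atTop := Nat.hyperfilter_le_atTop
  let lam : ℕ → ℝ := fun k => 1 / ((k : ℝ) + 1)
  have hlam : ∀ k, 0 < lam k := fun k => by positivity
  have hlam1 : ∀ k, lam k ≤ 1 := fun k => by
    rw [div_le_one (by positivity)]; linarith [k.cast_nonneg (α := ℝ)]
  have hlam0 : Tendsto lam U (𝓝 0) := tendsto_one_div_add_atTop_nhds_zero_nat.mono_left hU
  choose x hx using fun k ε => exists_regPenalty_minimizer q σ d (hlam k).le ε (hco ε)
  have hpow : ∀ y : ι → ℝ, 0 ≤ ∑ i, y i ^ (2 * d + 2) := fun y =>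
    Finset.sum_nonneg fun _ _ => (Even.pow_nonneg ⟨d + 1, by ring⟩ _)
  have hsq : ∀ y : ι → ℝ, 0 ≤ ∑ i, (y i - σ i) ^ 2 := fun y =>
    Finset.sum_nonneg fun _ _ => sq_nonneg _
  have hle : ∀ k ε y, penalty q ε (x k ε) + lam k * ∑ i, (x k ε i - σ i) ^ 2 ≤
      penalty q ε y + lam k * ∑ i, (y i - σ i) ^ 2 + lam k ^ 2 * ∑ i, y i ^ (2 * d + 2) :=
    fun k ε y => (penalty_le_regPenalty q σ d _ ε _).trans (hx k ε y)
  have hbdd : ∀ ε, ∃ R, ∀ k, ‖x k ε‖ ≤ R := by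
    intro ε
    obtain ⟨R, hR⟩ := hco ε (penalty q ε σ + ∑ i, σ i ^ (2 * d + 2))
    refine ⟨R, fun k => hR _ ?_⟩
    have h1 := hle k ε σ
    have h2 := mul_nonneg (hlam k).le (hsq (x k ε))
    have h3 : lam k ^ 2 * ∑ i, σ i ^ (2 * d + 2) ≤ ∑ i, σ i ^ (2 * d + 2) :=
      mul_le_of_le_one_left (hpow σ) (pow_le_one₀ (hlam k).le (hlam1 k))
    simp only [sub_self, ne_eq, OfNat.ofNat_ne_zero, not_false_eq_true, zero_pow,
      Finset.sum_const_zero, mul_zero] at h1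
    linarith
  choose z hz using fun ε => exists_ultralimit U (fun k => x k ε) _ (hbdd ε).choose_spec
  choose b hb using fun ε => exists_ultraconstant U fun k => violated q ε (x k ε)
  have heval : ∀ (p : MvPolynomial (Option ι) ℝ) ε,
      Tendsto (fun k => MvPolynomial.eval (paramPoint ε (x k ε)) p) U
        (𝓝 (MvPolynomial.eval (paramPoint ε (z ε)) p)) := fun p ε =>
    ((continuous_eval_paramPoint p ε).tendsto _).comp (hz ε)
  have hpen : ∀ ε, Tendsto (fun k => penalty q ε (x k ε)) U (𝓝 (penalty q ε (z ε))) := fun ε =>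
    ((continuous_penalty q ε).tendsto _).comp (hz ε)
  refine ⟨z, b, fun ε y => ?_, fun ε y hy => ?_, fun ε => ?_, fun B m J _ g hg hJ => ?_⟩
  · refine le_of_tendsto_of_tendsto' (hpen ε) ?_ fun k =>
      (le_add_of_nonneg_right (mul_nonneg (hlam k).le (hsq _))).trans (hle k ε y)
    have := (((hlam0.mul_const (∑ i, (y i - σ i) ^ 2)).const_add (penalty q ε y))).add
      ((hlam0.pow 2).mul_const (∑ i, y i ^ (2 * d + 2)))
    simpa using this
  · have h1 : Tendsto (fun k => ∑ i, (x k ε i - σ i) ^ 2) U (𝓝 (∑ i, (z ε i - σ i) ^ 2)) := by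
      have : Continuous fun y : ι → ℝ => ∑ i, (y i - σ i) ^ 2 := by fun_prop
      exact (this.tendsto _).comp (hz ε)
    have h2 : Tendsto (fun k => ∑ i, (y i - σ i) ^ 2 + lam k * ∑ i, y i ^ (2 * d + 2)) U
        (𝓝 (∑ i, (y i - σ i) ^ 2)) := by
      simpa using (hlam0.mul_const (∑ i, y i ^ (2 * d + 2))).const_add (∑ i, (y i - σ i) ^ 2)
    refine le_of_tendsto_of_tendsto' h1 h2 fun k => ?_
    have h3 := hle k ε y
    have h4 := penalty_nonneg q ε (x k ε)
    rw [hy] at h3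
    refine le_of_mul_le_mul_left ?_ (hlam k)
    nlinarith
  · have h1 : Tendsto (fun k => penalty q ε (x k ε)) U
        (𝓝 (∑ c ∈ b ε, MvPolynomial.eval (paramPoint ε (z ε)) (q c) ^ 2)) := by
      refine (tendsto_finsetSum _ fun c _ => (heval (q c) ε).pow 2).congr' ?_
      filter_upwards [hb ε] with k hk
      rw [penalty_eq_sum_violated, hk]
    exact tendsto_nhds_unique (hpen ε) h1
  · choose a ha0 ha using fun k => exists_relation_on_zeros (2 * d + 1)
      (fun i => criticalRhs q σ d (lam k) B i)
      (fun i => totalDegree_criticalRhs_lt q σ hd hq (lam k) B i) m g hg hJ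
    have hn : ∀ k, ‖(‖a k‖⁻¹ • a k)‖ = 1 := fun k => by
      rw [norm_smul, norm_inv, norm_norm, inv_mul_cancel₀ (norm_ne_zero_iff.2 (ha0 k))]
    obtain ⟨a', ha'⟩ := exists_ultralimit U (fun k => ‖a k‖⁻¹ • a k) 1 fun k => (hn k).le
    refine ⟨a', ?_, fun ε hε => ?_⟩
    · rintro rfl
      have := ha'.norm
      simp only [hn, norm_zero] at this
      exact one_ne_zero (tendsto_nhds_unique tendsto_const_nhds this)
    · have h1 : Tendsto (fun k => ∑ j, (‖a k‖⁻¹ • a k) j *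
          MvPolynomial.eval (paramPoint ε (x k ε)) (g j)) U
          (𝓝 (∑ j, a' j * MvPolynomial.eval (paramPoint ε (z ε)) (g j))) :=
        tendsto_finsetSum _ fun j _ => ((tendsto_pi_nhds.1 ha') j).mul (heval (g j) ε)
      refine tendsto_nhds_unique (h1.congr' ?_) (tendsto_const_nhds (x := (0 : ℝ)))
      filter_upwards [hb ε] with k hk
      have := ha k (paramPoint ε (x k ε)) fun i => by
        have := regPenalty_minimizer_critical q σ d (hlam k) ε (hx k ε) i
        rwa [hk, hε] at this
      simp only [Pi.smul_apply, smul_eq_mul, mul_assoc, ← Finset.mul_sum, this, mul_zero]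

end Ultralimits

/-- A positive solution `y ≤ 1` of a nontrivial polynomial relation with parameter `ε` is bounded
below by a power of `ε`. -/
theorem exists_root_lower_bound {A M : ℕ} (a : Fin (A + 1) × Fin M → ℝ) (ha : a ≠ 0) :
    ∃ c > 0, ∃ ε₀ > 0, ∀ ε y : ℝ, 0 < ε → ε < ε₀ → 0 < y → y ≤ 1 →
      ∑ p, a p * (ε ^ (p.1 : ℕ) * y ^ (p.2 : ℕ)) = 0 → c * ε ^ A ≤ y := by
  classical
  have hne : ∃ p, a p ≠ 0 := by
    by_contra! h
    exact ha (funext h)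
  obtain ⟨p₀, hp₀, hmin⟩ := (Set.toFinite {p | a p ≠ 0}).exists_minimalFor
    (fun p => toLex ((p.2 : ℕ), (p.1 : ℕ))) _ hne
  have hlt : ∀ p, p ≠ p₀ → a p ≠ 0 → p₀.2 < p.2 ∨ p₀.2 = p.2 ∧ p₀.1 < p.1 := by
    intro p hp hap
    by_contra! hcon
    have h1 : toLex ((p.2 : ℕ), (p.1 : ℕ)) ≤ toLex ((p₀.2 : ℕ), (p₀.1 : ℕ)) := by
      rw [Prod.Lex.toLex_le_toLex]
      rcases hcon.1.lt_or_eq with h | h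
      · exact Or.inl h
      · exact Or.inr ⟨by simp [h], hcon.2 h.symm⟩
    have h2 := hmin hap h1
    rw [Prod.Lex.toLex_le_toLex] at h1 h2
    apply hp
    ext <;> simp only at h1 h2 <;> omega
  set H := ∑ p, |a p| with hH
  have hH0 : 0 < H := lt_of_lt_of_le (abs_pos.2 hp₀)
    (Finset.single_le_sum (f := fun p => |a p|) (fun _ _ => abs_nonneg _) (Finset.mem_univ p₀))
  have ha0 := abs_pos.2 hp₀
  refine ⟨|a p₀| / (2 * H), by positivity, min 1 (|a p₀| / (2 * H)), by positivity,
    fun ε y hε hε₀ hy hy1 hsum => ?_⟩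
  obtain ⟨hε1, hε2⟩ := lt_min_iff.1 hε₀
  have hterm : ∀ p, p ≠ p₀ → |a p * (ε ^ (p.1 : ℕ) * y ^ (p.2 : ℕ))| ≤
      |a p| * (y ^ (p₀.2 : ℕ) * (ε ^ ((p₀.1 : ℕ) + 1) + y)) := by
    intro p hp
    by_cases hap : a p = 0
    · simp [hap]
    rw [abs_mul, abs_of_pos (by positivity : 0 < ε ^ (p.1 : ℕ) * y ^ (p.2 : ℕ))]
    refine mul_le_mul_of_nonneg_left ?_ (abs_nonneg _)
    rcases hlt p hp hap with h | ⟨h, h'⟩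
    · calc ε ^ (p.1 : ℕ) * y ^ (p.2 : ℕ) ≤ 1 * y ^ ((p₀.2 : ℕ) + 1) := by
            gcongr ?_ * ?_
            · exact pow_le_one₀ hε.le hε1.le
            · exact pow_le_pow_of_le_one hy.le hy1 h
        _ ≤ _ := by
            rw [one_mul, pow_succ]
            gcongr
            exact le_add_of_nonneg_left (by positivity)
    · rw [← h, mul_comm]
      gcongr
      exact (pow_le_pow_of_le_one hε.le hε1.le h').trans (le_add_of_nonneg_right hy.le)
  have hmain : |a p₀| * (ε ^ (p₀.1 : ℕ) * y ^ (p₀.2 : ℕ)) ≤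
      H * (y ^ (p₀.2 : ℕ) * (ε ^ ((p₀.1 : ℕ) + 1) + y)) := by
    rw [← Finset.add_sum_erase _ _ (Finset.mem_univ p₀)] at hsum
    have h1 : |a p₀ * (ε ^ (p₀.1 : ℕ) * y ^ (p₀.2 : ℕ))| ≤
        ∑ p ∈ Finset.univ.erase p₀, |a p * (ε ^ (p.1 : ℕ) * y ^ (p.2 : ℕ))| := by
      rw [eq_neg_of_add_eq_zero_left hsum, abs_neg]
      exact Finset.abs_sum_le_sum_abs _ _
    rw [abs_mul, abs_of_pos (by positivity : 0 < ε ^ (p₀.1 : ℕ) * y ^ (p₀.2 : ℕ))] at h1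
    refine h1.trans ?_
    rw [hH, Finset.sum_mul]
    refine (Finset.sum_le_sum fun p hp => hterm p (Finset.ne_of_mem_erase hp)).trans ?_
    exact Finset.sum_le_sum_of_subset_of_nonneg (Finset.erase_subset _ _)
      fun _ _ _ => by positivity
  have h2 : |a p₀| * ε ^ (p₀.1 : ℕ) ≤ H * (ε ^ ((p₀.1 : ℕ) + 1) + y) := by
    refine le_of_mul_le_mul_left ?_ (pow_pos hy (p₀.2 : ℕ))
    linarith
  rw [lt_div_iff₀ (by positivity)] at hε2
  have h3 : H * ε ^ ((p₀.1 : ℕ) + 1) ≤ |a p₀| / 2 * ε ^ (p₀.1 : ℕ) := by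
    rw [pow_succ, ← mul_assoc, mul_right_comm]
    gcongr
    linarith
  have h4 : ε ^ A ≤ ε ^ (p₀.1 : ℕ) :=
    pow_le_pow_of_le_one hε.le hε1.le (Nat.lt_succ_iff.1 p₀.1.2)
  calc |a p₀| / (2 * H) * ε ^ A ≤ |a p₀| / (2 * H) * ε ^ (p₀.1 : ℕ) := by gcongr
    _ ≤ y := by
      rw [div_mul_eq_mul_div, div_le_iff₀ (by positivity)]
      linarith

section PenaltyLowerBound

variable {ι Γ : Type*} [Fintype ι] [Fintype Γ]

/-- If a coercive system of polynomial inequalities with parameter is infeasible for all positive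
parameters, then its penalty is bounded below by an explicit power of the parameter. -/
theorem exists_penalty_lower_bound (q : Γ → MvPolynomial (Option ι) ℝ) {d : ℕ}
    (hd : 1 ≤ d) (hq : ∀ c, (q c).totalDegree ≤ d)
    (hco : ∀ ε M, ∃ R, ∀ x, penalty q ε x ≤ M → ‖x‖ ≤ R) (A : ℕ)
    (hA : 2 * d * (2 * (2 * d + 1) ^ Fintype.card ι - 1) < A + 1)
    (hinf : ∀ ε > 0, ∀ x, penalty q ε x ≠ 0) :
    ∃ c > 0, ∃ ε₀ > 0, ∀ ε, 0 < ε → ε < ε₀ → ∀ x, penalty q ε x ≤ 1 →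
      c * ε ^ A ≤ penalty q ε x := by
  classical
  obtain ⟨z, b, hz, -, hb, hrel⟩ := exists_algebraic_minimizers q 0 hd hq hco
  set n := (2 * d + 1) ^ Fintype.card ι
  have hn : 0 < n := by positivity
  have hB : ∀ B : Finset Γ, ∃ c > 0, ∃ ε₀ > 0, ∀ ε, 0 < ε → ε < ε₀ → b ε = B →
      penalty q ε (z ε) ≤ 1 → c * ε ^ A ≤ penalty q ε (z ε) := by
    intro B
    obtain ⟨a, ha, hrel⟩ := hrel B (A + 2 * d * (2 * n - 1)) (Fin (A + 1) × Fin (2 * n))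
      (fun p => MvPolynomial.X none ^ (p.1 : ℕ) * (∑ c ∈ B, q c ^ 2) ^ (p.2 : ℕ))
      (fun p => by
        refine (MvPolynomial.totalDegree_mul _ _).trans (add_le_add ?_ ?_)
        · rw [MvPolynomial.totalDegree_X_pow]
          exact Nat.lt_succ_iff.1 p.1.2
        · refine (MvPolynomial.totalDegree_pow _ _).trans ?_
          rw [mul_comm]
          refine Nat.mul_le_mul ?_ (by have := p.2.2; omega)
          refine (MvPolynomial.totalDegree_finsetSum _ _).trans (Finset.sup_le fun c _ => ?_)
          exact (MvPolynomial.totalDegree_pow _ _).trans (Nat.mul_le_mul_left 2 (hq c)))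
      (by
        simp only [Fintype.card_prod, Fintype.card_fin]
        calc (A + 2 * d * (2 * n - 1) + 1) * n < (2 * (A + 1)) * n :=
              Nat.mul_lt_mul_of_pos_right (by omega) hn
          _ = _ := by ring)
    obtain ⟨c, hc, ε₀, hε₀, h⟩ := exists_root_lower_bound a ha
    refine ⟨c, hc, ε₀, hε₀, fun ε hε hlt hbε h1 => ?_⟩
    refine h ε _ hε hlt (lt_of_le_of_ne (penalty_nonneg _ _ _) (hinf ε hε _).symm) h1 ?_
    rw [← hrel ε hbε, hb, hbε]
    refine Finset.sum_congr rfl fun p _ => ?_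
    simp [paramPoint]
  choose c hc ε₀ hε₀ h using hB
  refine ⟨Finset.univ.inf' Finset.univ_nonempty c, by simp [Finset.lt_inf'_iff, hc],
    Finset.univ.inf' Finset.univ_nonempty ε₀, by simp [Finset.lt_inf'_iff, hε₀],
    fun ε hε hlt x hx => ?_⟩
  refine le_trans ?_ (hz ε x)
  refine le_trans ?_ (h (b ε) ε hε (hlt.trans_le (Finset.inf'_le _ (Finset.mem_univ _))) rfl
    ((hz ε x).trans hx))
  gcongr
  exact Finset.inf'_le _ (Finset.mem_univ _)

end PenaltyLowerBound

section GainPolynomials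

variable {S : Fin N → Type} [∀ n, Fintype (S n)]

theorem payoff_update (G : Fin N → (∀ m, S m) → ℝ) (n : Fin N) (x : Profile S) (τ : S n → ℝ) :
    payoff G n (Function.update x n τ) =
      ∑ s : ∀ m, S m, (τ (s n) * ∏ m ∈ Finset.univ.erase n, x m (s m)) * G n s := by
  refine Finset.sum_congr rfl fun s _ => ?_
  rw [← Finset.mul_prod_erase _ _ (Finset.mem_univ n), Function.update_self]
  congr 2
  refine Finset.prod_congr rfl fun m hm => ?_
  rw [Function.update_of_ne (Finset.ne_of_mem_erase hm)]

variable [∀ n, DecidableEq (S n)]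

open MvPolynomial in
/-- The payoff difference between `σ n` and the pure strategy `s`, as a polynomial in the
strategies of the other players. -/
noncomputable def gainPoly (G : Fin N → (∀ m, S m) → ℝ) (σ : Profile S) (n : Fin N) (s : S n) :
    MvPolynomial (Σ n, S n) ℝ :=
  ∑ s' : ∀ m, S m, C ((σ n (s' n) - pureStrat s (s' n)) * G n s') *
    ∏ m ∈ Finset.univ.erase n, X ⟨m, s' m⟩

variable (G : Fin N → (∀ m, S m) → ℝ) (σ : Profile S) (n : Fin N) (s : S n)

open MvPolynomial in
theorem totalDegree_gainPoly_le : (gainPoly G σ n s).totalDegree ≤ N - 1 := by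
  refine (totalDegree_finsetSum _ _).trans (Finset.sup_le fun s' _ => ?_)
  refine (totalDegree_mul _ _).trans ?_
  rw [totalDegree_C, zero_add]
  refine (totalDegree_finsetProd _ _).trans ?_
  simp [totalDegree_X]

theorem eval_gainPoly (x : Profile S) :
    MvPolynomial.eval (fun p : Σ n, S n => x p.1 p.2) (gainPoly G σ n s) =
      payoff G n (Function.update x n (σ n)) - payoff G n (Function.update x n (pureStrat s)) := by
  rw [payoff_update, payoff_update, ← Finset.sum_sub_distrib, gainPoly, map_sum]
  refine Finset.sum_congr rfl fun s' _ => ?_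
  simp only [map_mul, map_prod, MvPolynomial.eval_C, MvPolynomial.eval_X]
  ring

theorem aeval_gainPoly_polynomial (η : PolyProfile S) :
    MvPolynomial.aeval (fun p : Σ n, S n => η p.1 p.2) (gainPoly G σ n s) =
      payoffPoly G η n (σ n) - payoffPoly G η n (pureStrat s) := by
  rw [payoffPoly, payoffPoly, ← Finset.sum_sub_distrib, gainPoly, map_sum]
  refine Finset.sum_congr rfl fun s' _ => ?_
  simp only [map_mul, map_prod, MvPolynomial.aeval_C, MvPolynomial.aeval_X, map_sub,
    Polynomial.algebraMap_eq]
  ring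

theorem aeval_gainPoly_scale {F : Type*} [CommRing F] [Algebra ℝ F] (x : (Σ n, S n) → F)
    (T : Fin N → F) :
    MvPolynomial.aeval (fun p => T p.1 * x p) (gainPoly G σ n s) =
      (∏ m ∈ Finset.univ.erase n, T m) * MvPolynomial.aeval x (gainPoly G σ n s) := by
  rw [gainPoly, map_sum, map_sum, Finset.mul_sum]
  refine Finset.sum_congr rfl fun s' _ => ?_
  simp only [map_mul, map_prod, MvPolynomial.aeval_C, MvPolynomial.aeval_X,
    Finset.prod_mul_distrib]
  ring

end GainPolynomials

section Beliefs

variable {S : Fin N → Type}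

theorem combine_self (n : Fin N) (sn : S n) (so : ∀ m : {m : Fin N // m ≠ n}, S m.val) :
    combine n sn so n = sn := by simp [combine]

theorem combine_of_ne (n : Fin N) (sn : S n) (so : ∀ m : {m : Fin N // m ≠ n}, S m.val)
    (m : {m : Fin N // m ≠ n}) : combine n sn so m.val = so m := by simp [combine, m.2]

variable [∀ n, Fintype (S n)] {K : ℕ}

/-- The polynomial strategy profile whose coefficients are the levels of an LPS profile. -/
noncomputable def lpsPoly (ϱ : ∀ n, Fin (K+1) → S n → ℝ) : PolyProfile S :=
  fun n s => ∑ k : Fin (K+1), Polynomial.C (ϱ n k s) * Polynomial.X ^ (k : ℕ)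

theorem coeff_prod_lpsPoly (ϱ : ∀ n, Fin (K+1) → S n → ℝ) (n : Fin N) (i : ℕ)
    (so : ∀ m : {m : Fin N // m ≠ n}, S m.val) :
    (∏ m : {m : Fin N // m ≠ n}, lpsPoly ϱ m.val (so m)).coeff i = ubelief ϱ n i so := by
  classical
  simp only [lpsPoly]
  rw [Finset.prod_univ_sum, Fintype.piFinset_univ, Polynomial.finsetSum_coeff, ubelief,
    Finset.sum_filter]
  refine Finset.sum_congr rfl fun kv _ => ?_
  rw [Finset.prod_mul_distrib, Finset.prod_pow_eq_pow_sum, ← map_prod,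
    Polynomial.coeff_C_mul_X_pow]
  simp only [eq_comm]

theorem sum_combine {R : Type*} [AddCommMonoid R] (n : Fin N) (f : (∀ m, S m) → R) :
    ∑ s, f s = ∑ so : ∀ m : {m : Fin N // m ≠ n}, S m.val, ∑ sn : S n, f (combine n sn so) := by
  classical
  rw [← Finset.sum_product', Finset.univ_product_univ]
  refine Fintype.sum_equiv ((Equiv.piSplitAt n S).trans (Equiv.prodComm _ _)) _ _ fun s => ?_
  congr 1
  funext m
  by_cases h : m = n
  · subst h; simp [combine]
  · simp [combine, h]

theorem coeff_payoffPoly_lpsPoly (G : Fin N → (∀ m, S m) → ℝ) (ϱ : ∀ n, Fin (K+1) → S n → ℝ)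
    (n : Fin N) (τ : S n → ℝ) (i : ℕ) :
    (payoffPoly G (lpsPoly ϱ) n τ).coeff i =
      beliefPayoff G n τ (ubelief ϱ n i) := by
  rw [payoffPoly, sum_combine n, beliefPayoff, Polynomial.finsetSum_coeff]
  refine Finset.sum_congr rfl fun so _ => ?_
  rw [Polynomial.finsetSum_coeff]
  refine Finset.sum_congr rfl fun sn _ => ?_
  have h : ∏ m ∈ Finset.univ.erase n, lpsPoly ϱ m (combine n sn so m) =
      ∏ m : {m : Fin N // m ≠ n}, lpsPoly ϱ m.val (so m) := by
    rw [Finset.prod_subtype (Finset.univ.erase n) (p := fun m => m ≠ n) (by simp)]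
    exact Finset.prod_congr rfl fun m _ => by rw [combine_of_ne]
  rw [combine_self, h, Polynomial.coeff_mul_C, Polynomial.coeff_C_mul, coeff_prod_lpsPoly]
  ring

theorem sum_ubelief_pos {ϱ : ∀ n, Fin (K+1) → S n → ℝ} (hϱ : IsLPSProfile ϱ) (hN : 2 ≤ N)
    (n : Fin N) {i : ℕ} (hi : i ≤ K) : 0 < ∑ so, ubelief ϱ n i so := by
  classical
  simp only [ubelief]
  rw [Finset.sum_comm]
  have h1 : ∀ kv : {m : Fin N // m ≠ n} → Fin (K+1),
      ∑ so : ∀ m : {m : Fin N // m ≠ n}, S m.val, ∏ m, ϱ m.val (kv m) (so m) = 1 := by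
    intro kv
    have := Finset.prod_univ_sum (fun m : {m : Fin N // m ≠ n} => (Finset.univ : Finset (S m.val)))
      (fun m s => ϱ m.val (kv m) s)
    rw [Fintype.piFinset_univ] at this
    rw [← this]
    exact Finset.prod_eq_one fun m _ => (hϱ m.val (kv m)).2
  simp only [h1, Finset.sum_const, nsmul_eq_mul, mul_one, Nat.cast_pos, Finset.card_pos]
  have : Nontrivial (Fin N) := Fin.nontrivial_iff_two_le.2 hN
  obtain ⟨m₀, hm₀⟩ := exists_ne n
  refine ⟨Function.update 0 ⟨m₀, hm₀⟩ ⟨i, by omega⟩, ?_⟩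
  rw [Finset.mem_filter]
  refine ⟨Finset.mem_univ _, ?_⟩
  rw [Finset.sum_eq_single ⟨m₀, hm₀⟩]
  · simp
  · intro m _ hm
    simp [hm]
  · simp

/-- The coefficients of `p` up to degree `k` are lexicographically nonnegative. -/
def LexNonneg (p : Polynomial ℝ) (k : ℕ) : Prop :=
  (∀ i ≤ k, p.coeff i = 0) ∨ ∃ i ≤ k, (∀ j < i, p.coeff j = 0) ∧ 0 < p.coeff i

theorem lpsBestReply_iff [∀ n, DecidableEq (S n)] (G : Fin N → (∀ m, S m) → ℝ)
    {ϱ : ∀ n, Fin (K+1) → S n → ℝ} (hϱ : IsLPSProfile ϱ) (hN : 2 ≤ N) (σ : Profile S) (n : Fin N)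
    {k : ℕ} (hk : k ≤ K) :
    lpsBestReply G ϱ n (σ n) k ↔ ∀ s : S n,
      LexNonneg (MvPolynomial.aeval (fun p : Σ n, S n => lpsPoly ϱ p.1 p.2) (gainPoly G σ n s)) k
      := by
  refine forall_congr' fun s => ?_
  rw [aeval_gainPoly_polynomial, lexGe, LexNonneg]
  have hb : ∀ (τ : S n → ℝ) (i : ℕ), beliefPayoff G n τ (belief ϱ n i) =
      (∑ so, ubelief ϱ n i so)⁻¹ * (payoffPoly G (lpsPoly ϱ) n τ).coeff i := by
    intro τ i
    rw [coeff_payoffPoly_lpsPoly, beliefPayoff, beliefPayoff, Finset.mul_sum]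
    refine Finset.sum_congr rfl fun so _ => ?_
    rw [Finset.mul_sum]
    refine Finset.sum_congr rfl fun sn _ => ?_
    rw [belief]
    ring
  have hpos : ∀ i ≤ k, 0 < (∑ so, ubelief ϱ n i so)⁻¹ := fun i hi =>
    inv_pos.2 (sum_ubelief_pos hϱ hN n (hi.trans hk))
  simp only [hb, Polynomial.coeff_sub]
  have heq : ∀ i ≤ k, ∀ u v : ℝ, (∑ so, ubelief ϱ n i so)⁻¹ * u =
      (∑ so, ubelief ϱ n i so)⁻¹ * v ↔ u - v = 0 := fun i hi u v => by
    rw [mul_right_inj' (hpos i hi).ne', sub_eq_zero]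
  refine or_congr (forall₂_congr fun i hi => heq i hi _ _) ?_
  refine exists_congr fun i => and_congr_right fun hi => and_congr ?_ ?_
  · exact forall₂_congr fun j hj => heq j (hj.le.trans hi) _ _
  · rw [mul_lt_mul_iff_right₀ (hpos i hi), sub_pos]

end Beliefs

section GameConstraints

variable {S : Fin N → Type} [∀ n, Fintype (S n)] [∀ n, DecidableEq (S n)]
  (G : Fin N → (∀ m, S m) → ℝ) (σ : Profile S)

open MvPolynomial in
/-- The polynomial constraints saying that `x` has coordinates at least `ε`, is `ρ`-close to `σ`,
and makes `σ` a best reply. -/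
noncomputable def gameConstraint (ρ : ℝ) :
    (Σ n, S n) ⊕ (Σ n, S n) ⊕ (Σ n, S n) ⊕ (Σ n, S n) → MvPolynomial (Option (Σ n, S n)) ℝ
  | .inl p => rename some (gainPoly G σ p.1 p.2)
  | .inr (.inl p) => X (some p) - X none
  | .inr (.inr (.inl p)) => X (some p) - C (σ p.1 p.2 - ρ)
  | .inr (.inr (.inr p)) => C (σ p.1 p.2 + ρ) - X (some p)

theorem totalDegree_gameConstraint_le (hN : 2 ≤ N) (ρ : ℝ)
    (c : (Σ n, S n) ⊕ (Σ n, S n) ⊕ (Σ n, S n) ⊕ (Σ n, S n)) :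
    (gameConstraint G σ ρ c).totalDegree ≤ N - 1 := by
  rcases c with p | p | p | p
  · exact (MvPolynomial.totalDegree_rename_le _ _).trans (totalDegree_gainPoly_le _ _ _ _)
  all_goals
    refine (MvPolynomial.totalDegree_sub _ _).trans ?_
    simp only [MvPolynomial.totalDegree_X, MvPolynomial.totalDegree_C]
    omega

variable {G σ} {ρ ε : ℝ} {x : (Σ n, S n) → ℝ}

theorem eval_gain_paramPoint (p : Σ n, S n) :
    MvPolynomial.eval (paramPoint ε x) (gameConstraint G σ ρ (.inl p)) =
      MvPolynomial.eval x (gainPoly G σ p.1 p.2) := by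
  rw [gameConstraint, MvPolynomial.eval_rename]
  rfl

theorem penalty_gameConstraint_eq_zero_iff :
    penalty (gameConstraint G σ ρ) ε x = 0 ↔
      (∀ p : Σ n, S n, 0 ≤ MvPolynomial.eval x (gainPoly G σ p.1 p.2)) ∧ (∀ p, ε ≤ x p) ∧
        ∀ p, |x p - σ p.1 p.2| ≤ ρ := by
  rw [penalty_eq_zero_iff]
  simp only [Sum.forall, eval_gain_paramPoint]
  refine and_congr_right fun _ => and_congr ?_ ?_
  · simp [gameConstraint, paramPoint]
  · rw [← forall_and]
    refine forall_congr' fun p => ?_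
    simp only [gameConstraint, paramPoint, map_sub, MvPolynomial.eval_C, MvPolynomial.eval_X,
      Option.elim, abs_le]
    constructor <;> rintro ⟨h1, h2⟩ <;> constructor <;> linarith

theorem gameConstraint_coercive (G : Fin N → (∀ m, S m) → ℝ) (σ : Profile S) (ρ ε M : ℝ) :
    ∃ R, ∀ x, penalty (gameConstraint G σ ρ) ε x ≤ M → ‖x‖ ≤ R := by
  refine ⟨‖fun p : Σ n, S n => σ p.1 p.2‖ + (|ρ| + |M| + 1), fun x hx => ?_⟩
  rw [pi_norm_le_iff_of_nonneg (by positivity)]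
  intro p
  have hterm : ∀ c, - (|M| + 1) ≤
      MvPolynomial.eval (paramPoint ε x) (gameConstraint G σ ρ c) := by
    intro c
    have h1 : min (MvPolynomial.eval (paramPoint ε x) (gameConstraint G σ ρ c)) 0 ^ 2 ≤ M :=
      (Finset.single_le_sum (f := fun c =>
        min (MvPolynomial.eval (paramPoint ε x) (gameConstraint G σ ρ c)) 0 ^ 2)
        (fun _ _ => sq_nonneg _) (Finset.mem_univ c)).trans hx
    refine le_trans ?_ (min_le_left _ 0)
    have h2 : M ≤ |M| := le_abs_self M
    nlinarith [abs_nonneg M]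
  have h1 := hterm (.inr (.inr (.inl p)))
  have h2 := hterm (.inr (.inr (.inr p)))
  simp only [gameConstraint, paramPoint, map_sub, MvPolynomial.eval_C, MvPolynomial.eval_X,
      Option.elim] at h1 h2
  have h3 : ‖σ p.1 p.2‖ ≤ ‖fun p : Σ n, S n => σ p.1 p.2‖ := norm_le_pi_norm
    (fun p : Σ n, S n => σ p.1 p.2) p
  rw [Real.norm_eq_abs] at h3 ⊢
  have h4 := abs_le.1 h3
  have h5 := le_abs_self ρ
  rw [abs_le]
  constructor <;> linarith

/-- Arbitrarily close positive profiles against which `σ` is a best reply give perfection. -/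
theorem isPerfect_of_feasible
    (h : ∀ ρ > 0, ∃ ε > 0, ∃ x, penalty (gameConstraint G σ ρ) ε x = 0)
    [∀ n, Nonempty (S n)] (hσ : IsMixed σ) : IsPerfect G σ := by
  choose ε hε x hx using fun k : ℕ => h (1 / ((k : ℝ) + 1)) (by positivity)
  simp only [penalty_gameConstraint_eq_zero_iff] at hx
  have hpos : ∀ k p, 0 < x k p := fun k p => (hε k).trans_le ((hx k).2.1 p)
  have hsum : ∀ k n, 0 < ∑ s, x k ⟨n, s⟩ := fun k n =>
    Finset.sum_pos (fun s _ => hpos k _) Finset.univ_nonempty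
  have hlim : ∀ p, Filter.Tendsto (fun k => x k p) Filter.atTop (nhds (σ p.1 p.2)) := by
    intro p
    rw [tendsto_iff_dist_tendsto_zero]
    refine squeeze_zero (fun _ => dist_nonneg) (fun k => ?_) tendsto_one_div_add_atTop_nhds_zero_nat
    exact (hx k).2.2 p
  refine ⟨fun k n s => (∑ s, x k ⟨n, s⟩)⁻¹ * x k ⟨n, s⟩, fun k => ⟨fun n => ⟨fun s => ?_, ?_⟩,
    fun n s => ?_⟩, ?_, fun k n s => ?_⟩
  · have := hsum k n; have := hpos k ⟨n, s⟩; positivity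
  · rw [← Finset.mul_sum, inv_mul_cancel₀ (hsum k n).ne']
  · have := hsum k n; have := hpos k ⟨n, s⟩; positivity
  · refine tendsto_pi_nhds.2 fun n => tendsto_pi_nhds.2 fun s => ?_
    have h1 : Filter.Tendsto (fun k => ∑ s, x k ⟨n, s⟩) Filter.atTop (nhds 1) := by
      rw [← (hσ n).2]
      exact tendsto_finsetSum _ fun s _ => hlim ⟨n, s⟩
    simpa using (h1.inv₀ one_ne_zero).mul (hlim ⟨n, s⟩)
  · have h1 := aeval_gainPoly_scale G σ n s (x k) fun n => (∑ s, x k ⟨n, s⟩)⁻¹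
    rw [MvPolynomial.aeval_eq_eval, MvPolynomial.aeval_eq_eval] at h1
    have h2 := eval_gainPoly G σ n s fun n s => (∑ s, x k ⟨n, s⟩)⁻¹ * x k ⟨n, s⟩
    rw [ge_iff_le, ← sub_nonneg, ← h2]
    refine le_of_le_of_eq ?_ h1.symm
    exact mul_nonneg (Finset.prod_nonneg fun m _ => (inv_pos.2 (hsum k m)).le) ((hx k).1 ⟨n, s⟩)

end GameConstraints

section PolynomialAsymptotics

open Filter Topology Polynomial

theorem LexNonneg.eventually_le {p : ℝ[X]} {k : ℕ} (h : LexNonneg p k) :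
    ∃ C : ℝ, ∀ᶠ t in 𝓝[>] (0 : ℝ), -C * t ^ (k + 1) ≤ p.eval t := by
  have hfac : ∀ i, (∀ j < i, p.coeff j = 0) → ∃ q : ℝ[X], p = X ^ i * q := fun i hi =>
    X_pow_dvd_iff.2 hi
  have hcont : ∀ q : ℝ[X], Tendsto (fun t => q.eval t) (𝓝[>] 0) (𝓝 (q.eval 0)) := fun q =>
    (q.continuous.tendsto 0).mono_left nhdsWithin_le_nhds
  rcases h with h | ⟨i, hi, hj, hp⟩
  · obtain ⟨q, rfl⟩ := hfac (k + 1) fun j hj => h j (by omega)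
    refine ⟨-(q.eval 0 - 1), ?_⟩
    filter_upwards [(hcont q).eventually_const_lt (sub_one_lt (q.eval 0)),
      self_mem_nhdsWithin] with t ht ht0
    simp only [eval_mul, eval_pow, eval_X, neg_neg]
    rw [mul_comm]
    exact mul_le_mul_of_nonneg_left ht.le (pow_nonneg (le_of_lt ht0) _)
  · obtain ⟨q, rfl⟩ := hfac i hj
    have hq : 0 < q.eval 0 := by
      rwa [coeff_X_pow_mul', if_pos le_rfl, Nat.sub_self, coeff_zero_eq_eval_zero] at hp
    refine ⟨0, ?_⟩
    filter_upwards [(hcont q).eventually_const_lt hq, self_mem_nhdsWithin] with t ht ht0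
    have : (0 : ℝ) < t := ht0
    simp only [eval_mul, eval_pow, eval_X]
    rw [neg_zero, zero_mul]
    positivity

end PolynomialAsymptotics

section LpsToPerfect

open Filter Topology

theorem exists_pos_le {α : Type*} [Finite α] (f : α → ℝ) (hf : ∀ a, 0 < f a) :
    ∃ c > 0, ∀ a, c ≤ f a := by
  cases isEmpty_or_nonempty α
  · exact ⟨1, one_pos, isEmptyElim⟩
  · obtain ⟨a, ha⟩ := Finite.exists_min f
    exact ⟨f a, hf a, ha⟩

variable {S : Fin N → Type} {K : ℕ} {ϱ : ∀ n, Fin (K+1) → S n → ℝ}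

theorem eval_lpsPoly (n : Fin N) (s : S n) (t : ℝ) :
    (lpsPoly ϱ n s).eval t = ∑ k : Fin (K+1), ϱ n k s * t ^ (k : ℕ) := by
  simp [lpsPoly, Polynomial.eval_finsetSum]

variable [∀ n, Fintype (S n)]

theorem exists_le_lpsLevel_ne_zero (hf : FullSupport ϱ) (n : Fin N) (s : S n) :
    ∃ i : Fin (K+1), (i : ℕ) ≤ lpsLevel ϱ ∧ ϱ n i s ≠ 0 := by
  have hne : {k : ℕ | ∀ s : S n, ∃ i : Fin (K+1), (i : ℕ) ≤ k ∧ ϱ n i s ≠ 0}.Nonempty :=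
    ⟨K, fun s => (hf n s).imp fun i hi => ⟨Nat.lt_succ_iff.1 i.2, hi⟩⟩
  obtain ⟨i, hi, h⟩ := Nat.sInf_mem hne s
  exact ⟨i, hi.trans (Finset.le_sup (f := fun n =>
    sInf {k : ℕ | ∀ s : S n, ∃ i : Fin (K+1), (i : ℕ) ≤ k ∧ ϱ n i s ≠ 0}) (Finset.mem_univ n)), h⟩

theorem isPerfect_of_lps [∀ n, DecidableEq (S n)] [∀ n, Nonempty (S n)]
    {G : Fin N → (∀ m, S m) → ℝ} {σ : Profile S} (hN : 2 ≤ N) (hσ : IsMixed σ)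
    (hϱ : IsLPSProfile ϱ) (hf : FullSupport ϱ) (h0 : ∀ n, ϱ n 0 = σ n) {L : ℕ}
    (hL : (N - 1) * (2 * (2 * (N - 1) + 1) ^ Fintype.card (Σ n, S n) - 1) ≤ L)
    (hK : lpsLevel ϱ * L ≤ K)
    (hbr : ∀ n, lpsBestReply G ϱ n (σ n) (lpsLevel ϱ * L)) : IsPerfect G σ := by
  refine isPerfect_of_feasible (fun ρ hρ => ?_) hσ
  by_contra! hinf
  obtain ⟨c, hc, ε₀, hε₀, hlow⟩ := exists_penalty_lower_bound (gameConstraint G σ ρ)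
    (d := N - 1) (by omega) (totalDegree_gameConstraint_le G σ hN ρ)
    (fun ε M => gameConstraint_coercive G σ ρ ε M) (2 * L) (by
      rw [mul_assoc]; omega) hinf
  set r := lpsLevel ϱ with hr
  let η : ℝ → (Σ n, S n) → ℝ := fun t p => (lpsPoly ϱ p.1 p.2).eval t
  have hηlow : ∃ c₁ > 0, ∀ p t, 0 < t → t ≤ 1 → c₁ * t ^ r ≤ η t p := by
    have : ∀ p : Σ n, S n, ∃ i : Fin (K+1), (i : ℕ) ≤ r ∧ ϱ p.1 i p.2 ≠ 0 := fun p =>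
      exists_le_lpsLevel_ne_zero hf p.1 p.2
    choose i hi hne using this
    obtain ⟨c₁, hc₁, hle⟩ := exists_pos_le (fun p : Σ n, S n => ϱ p.1 (i p) p.2)
      fun p => lt_of_le_of_ne ((hϱ _ _).1 _) (hne p).symm
    refine ⟨c₁, hc₁, fun p t ht ht1 => ?_⟩
    simp only [η]
    rw [eval_lpsPoly]
    refine le_trans ?_ (Finset.single_le_sum (f := fun k : Fin (K+1) => ϱ p.1 k p.2 * t ^ (k : ℕ))
      (fun k _ => mul_nonneg ((hϱ _ _).1 _) (by positivity)) (Finset.mem_univ (i p)))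
    exact mul_le_mul (hle p) (pow_le_pow_of_le_one ht.le ht1 (hi p)) (by positivity)
      ((hϱ _ _).1 _)
  obtain ⟨c₁, hc₁, hηlow⟩ := hηlow
  let c' := min c₁ (ε₀ / 2)
  have hc' : 0 < c' := lt_min hc₁ (by positivity)
  have hcon : ∀ a, ∃ C : ℝ, ∀ᶠ t in 𝓝[>] (0 : ℝ), -C * t ^ (r * L + 1) ≤
      MvPolynomial.eval (paramPoint (c' * t ^ r) (η t)) (gameConstraint G σ ρ a) := by
    have hev1 : ∀ᶠ t in 𝓝[>] (0 : ℝ), t ≤ 1 :=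
      nhdsWithin_le_nhds (Iic_mem_nhds one_pos)
    have hbox : ∀ p, ∀ᶠ t in 𝓝[>] (0 : ℝ), |η t p - σ p.1 p.2| < ρ := by
      intro p
      have h1 : Tendsto (fun t => η t p) (𝓝[>] 0) (𝓝 (η 0 p)) :=
        ((lpsPoly ϱ p.1 p.2).continuous.tendsto 0).mono_left nhdsWithin_le_nhds
      have h2 : η 0 p = σ p.1 p.2 := by
        simp only [η]
        rw [eval_lpsPoly, Finset.sum_eq_single 0]
        · rw [h0, Fin.val_zero, pow_zero, mul_one]
        · intro k _ hk
          rw [zero_pow (Fin.val_ne_zero_iff.2 hk), mul_zero]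
        · simp
      rw [h2] at h1
      exact h1.eventually (Metric.ball_mem_nhds _ hρ)
    rintro (p | p | p | p)
    · obtain ⟨C, hC⟩ := (((lpsBestReply_iff G hϱ hN σ p.1 hK).1 (hbr p.1)) p.2).eventually_le
      refine ⟨C, hC.mono fun t ht => ht.trans_eq ?_⟩
      rw [eval_gain_paramPoint, ← Polynomial.coe_evalRingHom, MvPolynomial.map_aeval]
      simp only [η]
      rw [MvPolynomial.eval, MvPolynomial.eval₂Hom_congr ?_ rfl rfl]
      · rfl
      · ext a; simp
    · refine ⟨0, ?_⟩
      filter_upwards [self_mem_nhdsWithin, hev1] with t ht0 ht1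
      have h1 := hηlow p t ht0 ht1
      have h2 : c' * t ^ r ≤ c₁ * t ^ r :=
        mul_le_mul_of_nonneg_right (min_le_left _ _) (pow_nonneg (le_of_lt ht0) _)
      simp only [gameConstraint, paramPoint, map_sub, MvPolynomial.eval_X, Option.elim]
      linarith
    all_goals
      refine ⟨0, ?_⟩
      filter_upwards [hbox p] with t ht
      have := abs_lt.1 ht
      simp only [gameConstraint, paramPoint, map_sub, MvPolynomial.eval_X, MvPolynomial.eval_C,
        Option.elim]
      linarith
  choose C hC using hcon
  have hpen : ∀ᶠ t in 𝓝[>] (0 : ℝ), penalty (gameConstraint G σ ρ) (c' * t ^ r) (η t) ≤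
      (∑ a, C a ^ 2) * (t ^ (r * L + 1)) ^ 2 := by
    filter_upwards [eventually_all.2 hC] with t ht
    rw [penalty, Finset.sum_mul]
    refine Finset.sum_le_sum fun a _ => ?_
    have h1 := ht a
    rcases le_total 0 (MvPolynomial.eval (paramPoint (c' * t ^ r) (η t))
      (gameConstraint G σ ρ a)) with h2 | h2
    · rw [min_eq_right h2, zero_pow two_ne_zero]; positivity
    · rw [min_eq_left h2, ← mul_pow]
      apply sq_le_sq'
      · linarith
      · nlinarith
  set H := ∑ a, C a ^ 2
  have hlim : Tendsto (fun t : ℝ => H * t ^ 2) (𝓝[>] 0) (𝓝 0) := by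
    have : Continuous fun t : ℝ => H * t ^ 2 := by fun_prop
    simpa using (this.tendsto 0).mono_left nhdsWithin_le_nhds
  have hsmall : ∀ᶠ t in 𝓝[>] (0 : ℝ), False := by
    filter_upwards [hpen, hlim.eventually_lt_const (u := min 1 (c * c' ^ (2 * L)))
      (by positivity), self_mem_nhdsWithin,
      nhdsWithin_le_nhds (Iic_mem_nhds one_pos)] with t h1 h2 ht0 ht1
    have ht0 : 0 < t := ht0
    have ht1 : t ≤ 1 := ht1
    obtain ⟨h2, h3⟩ := lt_min_iff.1 h2
    have h4 : H * (t ^ (r * L + 1)) ^ 2 = H * t ^ 2 * t ^ (r * (2 * L)) := by ring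
    rw [h4] at h1
    have h5 : t ^ (r * (2 * L)) ≤ 1 := pow_le_one₀ ht0.le ht1
    have h6 : 0 < t ^ (r * (2 * L)) := by positivity
    have hH : 0 ≤ H * t ^ 2 := mul_nonneg (Finset.sum_nonneg fun _ _ => sq_nonneg _) (sq_nonneg _)
    have h7 := hlow (c' * t ^ r) (by positivity) (by
      calc c' * t ^ r ≤ c' * 1 := by gcongr; exact pow_le_one₀ ht0.le ht1
        _ < ε₀ := by rw [mul_one]; exact (min_le_right _ _).trans_lt (by linarith)) (η t)
        (by nlinarith)
    rw [mul_pow, ← pow_mul, ← mul_assoc] at h7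
    have := (mul_lt_mul_of_pos_right h3 h6).trans_le (h7.trans h1)
    exact lt_irrefl _ this
  exact hsmall.exists.elim fun _ => id

end LpsToPerfect

section ValuedFields

open ArchimedeanClass

variable {𝕂 : Type*} [Field 𝕂] [LinearOrder 𝕂] [IsStrictOrderedRing 𝕂]

theorem mk_eq_zero_of_pow {y : 𝕂} {n : ℕ} (hn : n ≠ 0) (h : mk (y ^ n) = 0) : mk y = 0 := by
  rw [mk_pow] at h
  rcases lt_trichotomy (mk y) 0 with h' | h' | h'
  · exact absurd h (nsmul_neg h' hn).ne
  · exact h'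
  · exact absurd h (nsmul_pos h' hn).ne'

theorem mk_zpow_pos {y : 𝕂} (h : 0 < mk y) {k : ℤ} (hk : 0 < k) : 0 < mk (y ^ k) := by
  lift k to ℕ using hk.le
  rw [zpow_natCast, mk_pow]
  exact nsmul_pos h (by omega)

theorem mk_zpow_neg {y : 𝕂} (hy : y ≠ 0) (h : 0 < mk y) {k : ℤ} (hk : k < 0) : mk (y ^ k) < 0 := by
  have h1 := mk_zpow_pos h (neg_pos.2 hk)
  have h2 : mk (y ^ k) + mk (y ^ (-k)) = 0 := by
    rw [← mk_mul, ← zpow_add₀ hy]; simp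
  by_contra! h3
  exact (h1.trans_le (le_add_of_nonneg_left h3)).ne' h2

theorem eq_zero_of_mk_zpow_eq_zero {y : 𝕂} (hy : y ≠ 0) (h : 0 < mk y) {k : ℤ}
    (hk : mk (y ^ k) = 0) : k = 0 := by
  rcases lt_trichotomy k 0 with h' | h' | h'
  · exact absurd hk (mk_zpow_neg hy h h').ne
  · exact h'
  · exact absurd hk (mk_zpow_pos h h').ne'

theorem mk_mul_of_mk_eq_zero {u y : 𝕂} (hu : mk u = 0) : mk (u * y) = mk y := by
  rw [mk_mul, hu, zero_add]

/-- If a finite sum vanishes, the minimal valuation is attained at least twice. -/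
theorem exists_ne_mk_eq {J : Type*} [Fintype J] (f : J → 𝕂) (hf : ∃ j, f j ≠ 0)
    (hs : ∑ j, f j = 0) : ∃ j j', j ≠ j' ∧ mk (f j) = mk (f j') ∧ f j ≠ 0 ∧ f j' ≠ 0 := by
  classical
  have : Nonempty J := ⟨hf.choose⟩
  obtain ⟨j, hj⟩ := Finite.exists_min fun j => mk (f j)
  have hj0 : f j ≠ 0 := by
    obtain ⟨i, hi⟩ := hf
    intro h
    have := hj i
    rw [h, mk_zero, top_le_iff, mk_eq_top_iff] at this
    exact hi this
  by_contra! hcon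
  have hlt : ∀ i ∈ Finset.univ.erase j, mk (f j) < mk (f i) := by
    intro i hi
    refine lt_of_le_of_ne (hj i) fun h => ?_
    have h0 := hcon j i (Finset.ne_of_mem_erase hi).symm h hj0
    rw [h0, mk_zero, mk_eq_top_iff] at h
    exact hj0 h
  have h1 := (addValuation 𝕂).map_lt_sum (s := Finset.univ.erase j) (f := f) (g := mk (f j))
    (by rwa [Ne, mk_eq_top_iff]) hlt
  rw [← Finset.add_sum_erase _ _ (Finset.mem_univ j)] at hs
  rw [eq_neg_of_add_eq_zero_left hs, mk_neg] at h1
  exact lt_irrefl _ h1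

variable (𝕂) [Algebra ℝ 𝕂]

/-- The embedding of the reals into an ordered real algebra, as an ordered ring homomorphism. -/
noncomputable def realHom : ℝ →+*o 𝕂 where
  __ := algebraMap ℝ 𝕂
  monotone' := by
    intro a b hab
    rw [← sub_nonneg] at hab
    change algebraMap ℝ 𝕂 a ≤ algebraMap ℝ 𝕂 b
    rw [← sub_nonneg, ← map_sub, ← Real.mul_self_sqrt hab, map_mul]
    exact mul_self_nonneg _

/-- The elements of an ordered real algebra that are bounded by a real number. -/
noncomputable def finiteElements : Subalgebra ℝ 𝕂 where
  carrier := {y | 0 ≤ mk y}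
  mul_mem' := fun {a b} ha hb => by
    change 0 ≤ mk (a * b)
    rw [mk_mul]
    exact add_nonneg ha hb
  add_mem' := fun {a b} ha hb => by
    change 0 ≤ mk a at ha
    change 0 ≤ mk b at hb
    change 0 ≤ mk (a + b)
    exact (le_min ha hb).trans (min_le_mk_add a b)
  algebraMap_mem' r := mk_map_nonneg_of_archimedean (realHom 𝕂) r

variable {𝕂}

theorem mk_algebraMap {r : ℝ} (hr : r ≠ 0) : mk (algebraMap ℝ 𝕂 r) = 0 :=
  mk_map_of_archimedean' (realHom 𝕂) hr

variable {ι : Type*} {x : Option ι → 𝕂} {n₀ : ℕ}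

/-- Over the parameter `x none`, the coordinates of `x` generate an extension of degree at most
`n₀`, in the sense that there are as many linear relations as if this were so. -/
def HasRelations (x : Option ι → 𝕂) (n₀ : ℕ) : Prop :=
  ∀ (m : ℕ) (J : Type) [Fintype J] (g : J → MvPolynomial (Option ι) ℝ),
    (∀ j, (g j).totalDegree ≤ m) → (m + 1) * n₀ < Fintype.card J →
    ∃ a : J → ℝ, a ≠ 0 ∧ ∑ j, a j • MvPolynomial.aeval x (g j) = 0

theorem HasRelations.exists_mk_eq_zero (hrel : HasRelations x n₀) (hε : 0 < mk (x none))
    (hε0 : x none ≠ 0) (y : Fin (n₀ + 1) → 𝕂)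
    (hy : ∀ j, y j ∈ IntermediateField.adjoin ℝ (Set.range x)) (hy0 : ∀ j, y j ≠ 0) :
    ∃ i j, i < j ∧ ∃ b : ℤ, mk (y j / y i * x none ^ b) = 0 := by
  classical
  have hfrac : ∀ j, ∃ r s : MvPolynomial (Option ι) ℝ, MvPolynomial.aeval x s ≠ 0 ∧
      y j * MvPolynomial.aeval x s = MvPolynomial.aeval x r := by
    intro j
    obtain ⟨r, s, h⟩ := (IntermediateField.mem_adjoin_range_iff ℝ x (y j)).1 (hy j)
    have hs : MvPolynomial.aeval x s ≠ 0 := fun h0 => hy0 j (by rw [h, h0, div_zero])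
    exact ⟨r, s, hs, by rw [h, div_mul_cancel₀ _ hs]⟩
  choose r s hs hrs using hfrac
  let g : Fin (n₀ + 1) → MvPolynomial (Option ι) ℝ := fun j =>
    r j * ∏ k ∈ Finset.univ.erase j, s k
  set T := ∏ k, MvPolynomial.aeval x (s k) with hT
  have hT0 : T ≠ 0 := Finset.prod_ne_zero_iff.2 fun k _ => hs k
  have hg : ∀ j, MvPolynomial.aeval x (g j) = y j * T := by
    intro j
    simp only [g, map_mul, map_prod]
    rw [← hrs, mul_assoc, Finset.mul_prod_erase _ (fun k => MvPolynomial.aeval x (s k))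
      (Finset.mem_univ j)]
  set D := Finset.univ.sup fun j => (g j).totalDegree
  obtain ⟨a, ha, hsum⟩ := hrel ((D + 1) * n₀ + D) (Fin ((D + 1) * n₀ + 1) × Fin (n₀ + 1))
    (fun p => MvPolynomial.X none ^ (p.1 : ℕ) * g p.2)
    (fun p => by
      refine (MvPolynomial.totalDegree_mul _ _).trans (add_le_add ?_ ?_)
      · rw [MvPolynomial.totalDegree_X_pow]
        exact Nat.lt_succ_iff.1 p.1.2
      · exact Finset.le_sup (f := fun j => (g j).totalDegree) (Finset.mem_univ p.2))
    (by
      simp only [Fintype.card_prod, Fintype.card_fin]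
      nlinarith)
  have hne : ∃ p, a p • MvPolynomial.aeval x (MvPolynomial.X none ^ (p.1 : ℕ) * g p.2) ≠ 0 := by
    obtain ⟨p, hp⟩ := Function.ne_iff.1 ha
    refine ⟨p, smul_ne_zero hp ?_⟩
    rw [map_mul, map_pow, MvPolynomial.aeval_X, hg]
    exact mul_ne_zero (pow_ne_zero _ hε0) (mul_ne_zero (hy0 _) hT0)
  obtain ⟨p, p', hpp, hmk, hp0, hp0'⟩ := exists_ne_mk_eq _ hne hsum
  have hval : ∀ p, a p • MvPolynomial.aeval x (MvPolynomial.X none ^ (p.1 : ℕ) * g p.2) ≠ 0 →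
      mk (a p • MvPolynomial.aeval x (MvPolynomial.X none ^ (p.1 : ℕ) * g p.2)) =
        mk (x none ^ (p.1 : ℤ) * (y p.2 * T)) := by
    intro p hp
    rw [Algebra.smul_def, mk_mul_of_mk_eq_zero (mk_algebraMap (left_ne_zero_of_smul hp)), map_mul,
      map_pow, MvPolynomial.aeval_X, hg, zpow_natCast]
  rw [hval p hp0, hval p' hp0'] at hmk
  have hquot : ∀ u w : 𝕂, w ≠ 0 → mk u = mk w → mk (u / w) = 0 := by
    intro u w hw h
    have h1 : mk (u / w) + mk w = 0 + mk w := by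
      rw [← mk_mul, div_mul_cancel₀ _ hw, h, zero_add]
    exact add_right_cancel_of_ne_top (by rwa [Ne, mk_eq_top_iff])
      (by rw [h1, add_comm])
  have hnz : ∀ p : Fin ((D + 1) * n₀ + 1) × Fin (n₀ + 1), x none ^ (p.1 : ℤ) * (y p.2 * T) ≠ 0 :=
    fun p => mul_ne_zero (zpow_ne_zero _ hε0) (mul_ne_zero (hy0 _) hT0)
  have hred : ∀ p p' : Fin ((D + 1) * n₀ + 1) × Fin (n₀ + 1),
      x none ^ (p.1 : ℤ) * (y p.2 * T) / (x none ^ (p'.1 : ℤ) * (y p'.2 * T)) =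
        y p.2 / y p'.2 * x none ^ ((p.1 : ℤ) - p'.1) := by
    intro p p'
    rw [zpow_sub₀ hε0]
    have := hy0 p'.2
    have := zpow_ne_zero (p'.1 : ℤ) hε0
    field_simp
  rcases lt_trichotomy p.2 p'.2 with h | h | h
  · exact ⟨p.2, p'.2, h, _, by rw [← hred]; exact hquot _ _ (hnz p) hmk.symm⟩
  · exfalso
    have h1 := hquot _ _ (hnz p') hmk
    rw [hred, h, div_self (hy0 _), one_mul] at h1
    have h2 := eq_zero_of_mk_zpow_eq_zero hε0 hε h1
    apply hpp
    ext
    · omega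
    · rw [h]
  · exact ⟨p'.2, p.2, h, _, by rw [← hred]; exact hquot _ _ (hnz p') hmk⟩

/-- A uniformizer of the field generated by `x`. -/
theorem HasRelations.exists_uniformizer (hrel : HasRelations x n₀) (hε : 0 < mk (x none))
    (hε0 : 0 < x none) :
    ∃ π ∈ IntermediateField.adjoin ℝ (Set.range x), 0 < π ∧ 0 < mk π ∧
      (∃ q : ℕ, q ≤ n₀ ∧ mk (x none / π ^ q) = 0) ∧
      ∀ y ∈ IntermediateField.adjoin ℝ (Set.range x), y ≠ 0 → ∃ k : ℤ, mk (y / π ^ k) = 0 := by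
  classical
  set F := IntermediateField.adjoin ℝ (Set.range x)
  set ε := x none with hεdef
  have hεF : ε ∈ F := IntermediateField.subset_adjoin _ _ ⟨none, rfl⟩
  set Q := n₀.factorial
  have hQ : Q ≠ 0 := Nat.factorial_ne_zero _
  have hpow : ∀ y ∈ F, y ≠ 0 → ∃ w : ℤ, mk (y ^ Q / ε ^ w) = 0 := by
    intro y hy hy0
    obtain ⟨i, j, hij, b, hb⟩ := hrel.exists_mk_eq_zero hε hε0.ne' (fun j => y ^ (j : ℕ))
      (fun j => pow_mem hy _) (fun j => pow_ne_zero _ hy0)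
    have hs : (j : ℕ) - i ∣ Q := Nat.dvd_factorial (by omega) (by omega)
    obtain ⟨u, hu⟩ := hs
    refine ⟨-(b * u), ?_⟩
    have : y ^ Q / ε ^ (-(b * (u : ℤ))) = (y ^ (j : ℕ) / y ^ (i : ℕ) * ε ^ b) ^ u := by
      rw [div_eq_mul_inv (y ^ (j : ℕ)), ← pow_sub₀ _ hy0 (by omega : (i : ℕ) ≤ j), mul_pow, ← pow_mul, ← hu, zpow_neg,
        div_inv_eq_mul, zpow_mul, zpow_natCast]
    rw [this, mk_pow, hb, smul_zero]
  have hex : ∃ w : ℕ, 0 < w ∧ ∃ y ∈ F, 0 < y ∧ mk (y ^ Q / ε ^ (w : ℤ)) = 0 :=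
    ⟨Q, Nat.pos_of_ne_zero hQ, ε, hεF, hε0, by
      rw [zpow_natCast, div_self (pow_ne_zero _ hε0.ne'), mk_one]⟩
  obtain ⟨hw, π, hπF, hπ, hmk⟩ := Nat.find_spec hex
  have hmin := fun w => Nat.find_min hex (m := w)
  set w := Nat.find hex
  have hεw : ∀ k : ℤ, ε ^ k ≠ 0 := fun k => zpow_ne_zero k hε0.ne'
  have hπv : 0 < mk π := by
    by_contra! h
    have h1 : mk (π ^ Q) = mk (ε ^ (w : ℤ)) := by
      rw [← mk_mul_of_mk_eq_zero (y := ε ^ (w : ℤ)) hmk, div_mul_cancel₀ _ (hεw w)]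
    have h2 := mk_zpow_pos hε (Int.natCast_pos.2 hw)
    rw [← h1, mk_pow] at h2
    exact absurd h2 (nsmul_nonpos h Q).not_gt
  have hgen : ∀ y ∈ F, y ≠ 0 → ∃ k : ℤ, mk (y / π ^ k) = 0 := by
    intro y hy hy0
    obtain ⟨w', hw'⟩ := hpow y hy hy0
    refine ⟨w' / w, mk_eq_zero_of_pow hQ ?_⟩
    set k := w' / (w : ℤ)
    set r := w' % (w : ℤ) with hr
    have hr0 : 0 ≤ r := Int.emod_nonneg _ (by omega)
    have hrw : r < w := Int.emod_lt_of_pos _ (by omega)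
    have hdecomp : w' = w * k + r := (Int.mul_ediv_add_emod w' w).symm
    have h1 : mk ((y / π ^ k) ^ Q / ε ^ r) = 0 := by
      have : (y / π ^ k) ^ Q / ε ^ r = y ^ Q / ε ^ w' * ((π ^ Q / ε ^ (w : ℤ)) ^ k)⁻¹ := by
        rw [hdecomp, zpow_add₀ hε0.ne', div_pow, div_zpow, zpow_mul, ← zpow_natCast (π ^ k),
          ← zpow_mul, mul_comm k, zpow_mul, zpow_natCast]
        have := hεw r
        have := zpow_ne_zero k (hεw w)
        have := zpow_ne_zero k (pow_ne_zero Q hπ.ne')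
        field_simp
      rw [this, mk_mul, mk_inv, mk_zpow, hmk, hw']
      simp
    by_cases hr' : r = 0
    · rwa [hr', zpow_zero, div_one] at h1
    · exfalso
      clear_value r
      lift r to ℕ using hr0
      refine hmin r (by omega) ⟨by omega, |y / π ^ k|, ?_, ?_, ?_⟩
      · have hmem : y / π ^ k ∈ F := div_mem hy (zpow_mem hπF _)
        rcases abs_choice (y / π ^ k) with h | h <;> rw [h]
        · exact hmem
        · exact neg_mem hmem
      · exact abs_pos.2 (div_ne_zero hy0 (zpow_ne_zero _ hπ.ne'))
      · rw [← mk_abs, abs_div, abs_pow, abs_abs, ← abs_pow, ← abs_div, mk_abs]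
        exact h1
  refine ⟨π, hπF, hπ, hπv, ?_, hgen⟩
  obtain ⟨q, hq⟩ := hgen ε hεF hε0.ne'
  have hq0 : 0 < q := by
    by_contra! h
    have h1 : mk ε = mk (π ^ q) := by
      rw [← mk_mul_of_mk_eq_zero (y := π ^ q) hq, div_mul_cancel₀ _ (zpow_ne_zero _ hπ.ne')]
    rw [h1] at hε
    rcases h.lt_or_eq with h | h
    · exact absurd hε (mk_zpow_neg hπ.ne' hπv h).not_gt
    · rw [h, zpow_zero, mk_one] at hε
      exact lt_irrefl _ hε
  lift q to ℕ using hq0.le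
  refine ⟨q, ?_, by rwa [zpow_natCast] at hq⟩
  obtain ⟨i, j, hij, b, hb⟩ := hrel.exists_mk_eq_zero hε hε0.ne' (fun j => π ^ (j : ℕ))
      (fun j => pow_mem hπF _) (fun j => pow_ne_zero _ hπ.ne')
  have h1 : mk (π ^ ((j : ℤ) - i + q * b)) = 0 := by
    have : π ^ ((j : ℤ) - i + q * b) =
        π ^ (j : ℕ) / π ^ (i : ℕ) * ε ^ b * ((ε / π ^ (q : ℤ)) ^ b)⁻¹ := by
      rw [zpow_add₀ hπ.ne', zpow_sub₀ hπ.ne', zpow_mul, div_zpow, zpow_natCast, zpow_natCast]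
      have := hεw b
      have := zpow_ne_zero b (zpow_ne_zero q hπ.ne')
      have := pow_ne_zero (i : ℕ) hπ.ne'
      field_simp
    rw [this, mk_mul, hb, mk_inv, mk_zpow, hq]
    simp
  have h2 := eq_zero_of_mk_zpow_eq_zero hπ.ne' hπv h1
  have h3 : (q : ℤ) ∣ (j : ℤ) - i := ⟨-b, by linarith⟩
  have h4 := Int.le_of_dvd (by omega) h3
  omega

end ValuedFields

section Expansions

open ArchimedeanClass Filter Topology
open scoped Polynomial

variable {𝕂 : Type*} [Field 𝕂] [LinearOrder 𝕂] [IsStrictOrderedRing 𝕂] [Algebra ℝ 𝕂]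

theorem mem_finiteElements_of_pos {y : 𝕂} (h : 0 < mk y) : y ∈ finiteElements 𝕂 := h.le

theorem mem_finiteElements_of_eq_zero {y : 𝕂} (h : mk y = 0) : y ∈ finiteElements 𝕂 := h.ge

theorem mk_mul_pos {y w : 𝕂} (hy : 0 < mk y) (hw : w ∈ finiteElements 𝕂) : 0 < mk (y * w) := by
  rw [mk_mul]
  exact hy.trans_le (le_add_of_nonneg_right hw)

theorem aeval_mem_finiteElements {π : 𝕂} (hπ : π ∈ finiteElements 𝕂) (P : ℝ[X]) :
    Polynomial.aeval π P ∈ finiteElements 𝕂 := by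
  rw [Polynomial.aeval_eq_sum_range]
  exact sum_mem fun i _ => Subalgebra.smul_mem _ (pow_mem hπ i) _

theorem mvAeval_mem_finiteElements {ι : Type*} {z : ι → 𝕂} (hz : ∀ p, z p ∈ finiteElements 𝕂)
    (f : MvPolynomial ι ℝ) : MvPolynomial.aeval z f ∈ finiteElements 𝕂 := by
  induction f using MvPolynomial.induction_on with
  | C a => rw [MvPolynomial.aeval_C]; exact Subalgebra.algebraMap_mem _ a
  | add p q hp hq => rw [map_add]; exact add_mem hp hq
  | mul_X p i hp => rw [map_mul, MvPolynomial.aeval_X]; exact mul_mem hp (hz i)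

theorem exists_aeval_add_mul {ι : Type*} {z r : ι → 𝕂} {h : 𝕂}
    (hz : ∀ p, z p ∈ finiteElements 𝕂) (hr : ∀ p, r p ∈ finiteElements 𝕂)
    (hh : h ∈ finiteElements 𝕂) (f : MvPolynomial ι ℝ) :
    ∃ t ∈ finiteElements 𝕂,
      MvPolynomial.aeval (fun p => z p + h * r p) f = MvPolynomial.aeval z f + h * t := by
  induction f using MvPolynomial.induction_on with
  | C a => exact ⟨0, zero_mem _, by simp⟩
  | add p q hp hq =>
    obtain ⟨t, ht, h1⟩ := hp
    obtain ⟨t', ht', h2⟩ := hq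
    exact ⟨t + t', add_mem ht ht', by rw [map_add, map_add, h1, h2]; ring⟩
  | mul_X p i hp =>
    obtain ⟨t, ht, h1⟩ := hp
    refine ⟨t * z i + MvPolynomial.aeval z p * r i + h * t * r i,
      add_mem (add_mem (mul_mem ht (hz i)) (mul_mem (mvAeval_mem_finiteElements hz p) (hr i)))
        (mul_mem (mul_mem hh ht) (hr i)), ?_⟩
    rw [map_mul, map_mul, h1, MvPolynomial.aeval_X, MvPolynomial.aeval_X]
    ring

/-- Taylor expansion of a finite element at a uniformizer. -/
theorem exists_expansion {F : IntermediateField ℝ 𝕂} {π : 𝕂} (hπF : π ∈ F) (hπ : π ≠ 0)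
    (hπv : 0 < mk π) (hgen : ∀ y ∈ F, y ≠ 0 → ∃ k : ℤ, mk (y / π ^ k) = 0) (M : ℕ) :
    ∀ y ∈ F, y ∈ finiteElements 𝕂 → ∃ P : ℝ[X], (∀ j, M ≤ j → P.coeff j = 0) ∧
      ∃ r ∈ finiteElements 𝕂, y = Polynomial.aeval π P + π ^ M * r := by
  induction M with
  | zero => exact fun y _ hy => ⟨0, by simp, y, hy, by simp⟩
  | succ M ih =>
    intro y hyF hy
    set c := stdPart y
    have hc : 0 < mk (y - algebraMap ℝ 𝕂 c) := mk_sub_stdPart_pos (realHom 𝕂) hy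
    have hw : (y - algebraMap ℝ 𝕂 c) / π ∈ finiteElements 𝕂 := by
      by_cases h0 : y - algebraMap ℝ 𝕂 c = 0
      · rw [h0, zero_div]; exact zero_mem _
      obtain ⟨k, hk⟩ := hgen _ (sub_mem hyF (F.algebraMap_mem c)) h0
      have hyk : y - algebraMap ℝ 𝕂 c = (y - algebraMap ℝ 𝕂 c) / π ^ k * π ^ k :=
        (div_mul_cancel₀ _ (zpow_ne_zero _ hπ)).symm
      have hk0 : 0 < k := by
        by_contra! h
        rw [hyk, mk_mul_of_mk_eq_zero hk] at hc
        rcases h.lt_or_eq with h | h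
        · exact absurd hc (mk_zpow_neg hπ hπv h).not_gt
        · rw [h, zpow_zero, mk_one] at hc
          exact lt_irrefl _ hc
      have : (y - algebraMap ℝ 𝕂 c) / π = (y - algebraMap ℝ 𝕂 c) / π ^ k * π ^ (k - 1) := by
        rw [zpow_sub_one₀ hπ]
        have := zpow_ne_zero k hπ
        field_simp
      rw [this]
      refine mul_mem (mem_finiteElements_of_eq_zero hk) ?_
      lift k to ℕ using hk0.le
      have h1 : ((k : ℤ) - 1) = ((k - 1 : ℕ) : ℤ) := by omega
      rw [h1, zpow_natCast]
      exact pow_mem (mem_finiteElements_of_pos hπv) _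
    obtain ⟨P, hPM, r, hr, h⟩ := ih _ (div_mem (sub_mem hyF (F.algebraMap_mem c)) hπF) hw
    refine ⟨Polynomial.C c + Polynomial.X * P, fun j hj => ?_, r, hr, ?_⟩
    · obtain ⟨j, rfl⟩ : ∃ i, j = i + 1 := ⟨j - 1, by omega⟩
      rw [Polynomial.coeff_add, Polynomial.coeff_C_succ, Polynomial.coeff_X_mul, zero_add]
      exact hPM j (by omega)
    rw [div_eq_iff hπ] at h
    rw [map_add, map_mul, Polynomial.aeval_C, Polynomial.aeval_X, pow_succ]
    linear_combination h

theorem exists_mk_factor_pow {π : 𝕂} (hπv : 0 < mk π) {M i : ℕ} (hi : i ≤ M) {P : ℝ[X]}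
    (hP : ∀ j < i, P.coeff j = 0) {r : 𝕂} (hr : r ∈ finiteElements 𝕂) :
    ∃ t ∈ finiteElements 𝕂, Polynomial.aeval π P + π ^ M * r = π ^ i * t ∧
      (i < M → stdPart t = P.coeff i) := by
  have hπ' := mem_finiteElements_of_pos hπv
  obtain ⟨P', rfl⟩ := Polynomial.X_pow_dvd_iff.2 hP
  refine ⟨Polynomial.aeval π P' + π ^ (M - i) * r,
    add_mem (aeval_mem_finiteElements hπ' _) (mul_mem (pow_mem hπ' _) hr), ?_, fun h => ?_⟩
  · rw [map_mul, map_pow, Polynomial.aeval_X, mul_add, ← mul_assoc, ← pow_add,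
      Nat.add_sub_cancel' hi]
  · obtain ⟨m, hm⟩ : ∃ m, M - i = m + 1 := ⟨M - i - 1, by omega⟩
    rw [Polynomial.coeff_X_pow_mul', if_pos le_rfl, Nat.sub_self, hm]
    have : Polynomial.aeval π P' + π ^ (m + 1) * r =
        algebraMap ℝ 𝕂 (P'.coeff 0) + π * (Polynomial.aeval π P'.divX + π ^ m * r) := by
      conv_lhs => rw [← P'.X_mul_divX_add]
      rw [map_add, map_mul, Polynomial.aeval_X, Polynomial.aeval_C]
      ring
    rw [this, stdPart_add_eq_left (mk_mul_pos hπv (add_mem (aeval_mem_finiteElements hπ' _)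
      (mul_mem (pow_mem hπ' _) hr)))]
    exact stdPart_map_real (realHom 𝕂) _

theorem coeff_zero_of_expansion {π : 𝕂} (hπv : 0 < mk π) {K : ℕ} {P : ℝ[X]} {r : 𝕂}
    (hr : r ∈ finiteElements 𝕂) :
    P.coeff 0 = stdPart (Polynomial.aeval π P + π ^ (K + 1) * r) := by
  obtain ⟨t, -, h, h'⟩ := exists_mk_factor_pow hπv (Nat.zero_le (K + 1)) (P := P) (by simp) hr
  rw [h, pow_zero, one_mul, h' K.succ_pos]

theorem lexNonneg_of_nonneg {π : 𝕂} (hπ : 0 < π) (hπv : 0 < mk π) {K : ℕ} {P : ℝ[X]} {r : 𝕂}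
    (hr : r ∈ finiteElements 𝕂) (h : 0 ≤ Polynomial.aeval π P + π ^ (K + 1) * r) :
    LexNonneg P K := by
  classical
  by_cases hall : ∀ i ≤ K, P.coeff i = 0
  · exact Or.inl hall
  push Not at hall
  obtain ⟨hiK, hi0⟩ := Nat.find_spec hall
  have hmin := fun j => Nat.find_min hall (m := j)
  set i := Nat.find hall
  have hlow : ∀ j < i, P.coeff j = 0 := fun j hj => by
    by_contra h0
    exact hmin j hj ⟨by omega, h0⟩
  refine Or.inr ⟨i, hiK, hlow, lt_of_le_of_ne ?_ hi0.symm⟩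
  obtain ⟨t, -, ht, hst⟩ := exists_mk_factor_pow hπv (by omega : i ≤ K + 1) hlow hr
  rw [← hst (by omega)]
  rw [ht] at h
  exact stdPart_nonneg (nonneg_of_mul_nonneg_right h (pow_pos hπ i))

theorem coeff_eq_zero_of_expansion {π : 𝕂} (hπ : 0 < π) (hπv : 0 < mk π) {K : ℕ} {P : ℝ[X]} {r : 𝕂}
    (hr : r ∈ finiteElements 𝕂) (h : Polynomial.aeval π P + π ^ (K + 1) * r = 0) {i : ℕ}
    (hi : i ≤ K) : P.coeff i = 0 := by
  have h1 := lexNonneg_of_nonneg hπ hπv hr h.ge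
  have h2 := lexNonneg_of_nonneg (P := -P) hπ hπv (neg_mem hr) (by
    rw [map_neg]; linear_combination h)
  rcases h1 with h1 | ⟨j, -, hj, hj'⟩
  · exact h1 i hi
  rcases h2 with h2 | ⟨k, -, hk, hk'⟩
  · simpa using h2 i hi
  simp only [Polynomial.coeff_neg, neg_eq_zero] at hk hk'
  rcases lt_trichotomy j k with h | h | h
  · exact absurd (hk j h) hj'.ne'
  · subst h; linarith
  · have := hj k h
    linarith

theorem exists_coeff_ne_zero {π : 𝕂} (hπ : π ≠ 0) (hπv : 0 < mk π) {K q : ℕ} (hq : q ≤ K) {P : ℝ[X]}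
    {r : 𝕂} (hr : r ∈ finiteElements 𝕂)
    (h : mk (Polynomial.aeval π P + π ^ (K + 1) * r) ≤ mk (π ^ q)) :
    ∃ j ≤ q, P.coeff j ≠ 0 := by
  by_contra! hcon
  obtain ⟨t, ht, heq, -⟩ := exists_mk_factor_pow hπv (by omega : q + 1 ≤ K + 1) (P := P)
    (fun j hj => hcon j (by omega)) hr
  rw [heq, pow_succ, mul_assoc, mk_mul] at h
  have h1 := mk_mul_pos hπv ht
  refine absurd h (not_le.2 (lt_of_le_of_ne (le_add_of_nonneg_right h1.le) fun h2 => ?_))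
  refine h1.ne (add_left_cancel_of_ne_top (x := mk (π ^ q)) ?_ (by rw [add_zero, ← h2]))
  rw [Ne, mk_eq_top_iff]
  exact pow_ne_zero _ hπ

theorem LexNonneg.mono {P : ℝ[X]} {K k : ℕ} (h : LexNonneg P K) (hk : k ≤ K) : LexNonneg P k := by
  rcases h with h | ⟨i, -, h, h'⟩
  · exact Or.inl fun i hi => h i (hi.trans hk)
  · rcases le_or_gt i k with hik | hik
    · exact Or.inr ⟨i, hik, h, h'⟩
    · exact Or.inl fun j hj => h j (by omega)

theorem LexNonneg.eventually_partialSum {P : ℝ[X]} {k : ℕ} (h : LexNonneg P k) :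
    ∀ᶠ t : ℝ in 𝓝[>] 0, 0 ≤ ∑ j ∈ Finset.range (k + 1), P.coeff j * t ^ j ∧
      ((∃ j ≤ k, P.coeff j ≠ 0) → 0 < ∑ j ∈ Finset.range (k + 1), P.coeff j * t ^ j) := by
  rcases h with h | ⟨i, hi, h, h'⟩
  · refine Eventually.of_forall fun t => ⟨?_, fun ⟨j, hj, hj'⟩ => absurd (h j hj) hj'⟩
    rw [Finset.sum_eq_zero fun j hj => by rw [h j (by simpa [Nat.lt_succ_iff] using hj), zero_mul]]
  · have hc : ContinuousAt (fun t : ℝ => ∑ j ∈ Finset.range (k + 1), P.coeff j * t ^ (j - i)) 0 := by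
      fun_prop
    have h0 : ∑ j ∈ Finset.range (k + 1), P.coeff j * (0 : ℝ) ^ (j - i) = P.coeff i := by
      rw [Finset.sum_eq_single i]
      · simp
      · intro j _ hj
        rcases lt_or_gt_of_ne hj with hj | hj
        · rw [h j hj, zero_mul]
        · rw [zero_pow (by omega), mul_zero]
      · intro hj; simp at hj; omega
    have hev := hc.eventually (lt_mem_nhds (h'.trans_eq h0.symm))
    filter_upwards [nhdsWithin_le_nhds hev, self_mem_nhdsWithin] with t ht ht0
    have heq : ∑ j ∈ Finset.range (k + 1), P.coeff j * t ^ j =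
        t ^ i * ∑ j ∈ Finset.range (k + 1), P.coeff j * t ^ (j - i) := by
      rw [Finset.mul_sum]
      refine Finset.sum_congr rfl fun j _ => ?_
      rcases lt_or_ge j i with hj | hj
      · rw [h j hj]; simp
      · rw [mul_left_comm, ← pow_add, Nat.add_sub_cancel' hj]
    have hpos : 0 < ∑ j ∈ Finset.range (k + 1), P.coeff j * t ^ j := by
      rw [heq]; exact mul_pos (pow_pos ht0 i) ht
    exact ⟨hpos.le, fun _ => hpos⟩

end Expansions

section Construction

open ArchimedeanClass Topology
open Filter (eventually_all)
open scoped Polynomial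

theorem one_sub_mul_sum_partialSum {R : Type*} [CommRing R] (f : ℕ → R) (y : R) (K : ℕ) :
    (1 - y) * ∑ k ∈ Finset.range (K + 1), (∑ j ∈ Finset.range (k + 1), f j) * y ^ k =
      ∑ j ∈ Finset.range (K + 1), f j * y ^ j
        - (∑ j ∈ Finset.range (K + 1), f j) * y ^ (K + 1) := by
  induction K with
  | zero => simp; ring
  | succ K ih =>
    rw [Finset.sum_range_succ, mul_add, ih, Finset.sum_range_succ (fun j => f j * y ^ j) (K + 1),
      Finset.sum_range_succ f (K + 1)]
    ring

variable {𝕂 : Type*} [Field 𝕂] [LinearOrder 𝕂] [IsStrictOrderedRing 𝕂] [Algebra ℝ 𝕂]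
variable {S : Fin N → Type} [∀ n, Fintype (S n)] [∀ n, DecidableEq (S n)]

/-- Summing the scaled Taylor coefficients of a germ of completely mixed strategies gives an LPS
profile. -/
theorem exists_lps_of_normalized_germ (hN : 2 ≤ N) (G : Fin N → (∀ m, S m) → ℝ) (σ : Profile S)
    {F : IntermediateField ℝ 𝕂} {π : 𝕂} (hπF : π ∈ F) (hπ : 0 < π)
    (hπv : 0 < mk π) (hgen : ∀ y ∈ F, y ≠ 0 → ∃ k : ℤ, mk (y / π ^ k) = 0)
    {q K : ℕ} (hq : q ≤ K) {z : (Σ n, S n) → 𝕂} (hzF : ∀ p, z p ∈ F) (hz : ∀ p, 0 < z p)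
    (hzq : ∀ p, mk (z p) ≤ mk (π ^ q)) (hsum : ∀ n, ∑ s, z ⟨n, s⟩ = 1)
    (hσ : ∀ p, 0 < mk (z p - algebraMap ℝ 𝕂 (σ p.1 p.2)))
    (hgain : ∀ n s, 0 ≤ MvPolynomial.aeval z (gainPoly G σ n s)) :
    ∃ ϱ : ∀ n, Fin (K + 1) → S n → ℝ, IsLPSProfile ϱ ∧ FullSupport ϱ ∧ lpsLevel ϱ ≤ q ∧
      (∀ n, ϱ n 0 = σ n) ∧ ∀ n, ∀ k ≤ K, lpsBestReply G ϱ n (σ n) k := by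
  have hπf := mem_finiteElements_of_pos hπv
  have hreal : ∀ c : ℝ, algebraMap ℝ 𝕂 c ∈ finiteElements 𝕂 := Subalgebra.algebraMap_mem _
  have hzfin : ∀ p, z p ∈ finiteElements 𝕂 := fun p => by
    have := add_mem (mem_finiteElements_of_pos (hσ p)) (hreal (σ p.1 p.2))
    rwa [sub_add_cancel] at this
  choose P hPK r hr hP using fun p => exists_expansion hπF hπ.ne' hπv hgen (K + 1) (z p) (hzF p)
    (hzfin p)
  have hlex : ∀ p, LexNonneg (P p) K := fun p =>
    lexNonneg_of_nonneg hπ hπv (hr p) (by rw [← hP]; exact (hz p).le)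
  have hne : ∀ p, ∃ j ≤ q, (P p).coeff j ≠ 0 := fun p =>
    exists_coeff_ne_zero hπ.ne' hπv hq (hr p) (by rw [← hP]; exact hzq p)
  have hzero : ∀ p : Σ n, S n, (P p).coeff 0 = σ p.1 p.2 := fun p => by
    rw [coeff_zero_of_expansion hπv (K := K) (hr p), ← hP]
    have := stdPart_add_eq_right (y := algebraMap ℝ 𝕂 (σ p.1 p.2)) (hσ p)
    rw [sub_add_cancel] at this
    exact this.trans (stdPart_map_real (realHom 𝕂) _)
  have hcsum : ∀ n, ∀ j ≤ K, ∑ s, (P ⟨n, s⟩).coeff j = if j = 0 then 1 else 0 := by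
    intro n j hj
    have h1 := coeff_eq_zero_of_expansion (P := ∑ s, P ⟨n, s⟩ - 1) (r := ∑ s, r ⟨n, s⟩) hπ hπv
      (K := K) (sum_mem fun s _ => hr ⟨n, s⟩) (by
        rw [map_sub, map_sum, map_one, Finset.mul_sum, sub_add_eq_add_sub,
          ← Finset.sum_add_distrib]
        simp_rw [← hP]
        rw [hsum, sub_self]) hj
    rw [Polynomial.coeff_sub, Polynomial.finsetSum_coeff, Polynomial.coeff_one, sub_eq_zero] at h1
    exact h1
  have hev : ∀ᶠ t : ℝ in 𝓝[>] 0, 0 < t ∧ ∀ (p : Σ n, S n) (k : Fin (K + 1)),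
      0 ≤ ∑ j ∈ Finset.range ((k : ℕ) + 1), (P p).coeff j * t ^ j ∧
      ((∃ j ≤ (k : ℕ), (P p).coeff j ≠ 0) →
        0 < ∑ j ∈ Finset.range ((k : ℕ) + 1), (P p).coeff j * t ^ j) :=
    (eventually_mem_nhdsWithin (s := Set.Ioi (0 : ℝ))).and (eventually_all.2 fun p => eventually_all.2 fun k =>
      ((hlex p).mono (Nat.lt_succ_iff.1 k.2)).eventually_partialSum)
  obtain ⟨θ, hθ, hA⟩ := hev.exists
  let ϱ : ∀ n, Fin (K + 1) → S n → ℝ := fun n k s =>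
    ∑ j ∈ Finset.range ((k : ℕ) + 1), (P ⟨n, s⟩).coeff j * θ ^ j
  have hpos : ∀ n s (k : Fin (K + 1)), q ≤ k → 0 < ϱ n k s := fun n s k hk =>
    (hA ⟨n, s⟩ k).2 ((hne ⟨n, s⟩).imp fun j hj => ⟨hj.1.trans hk, hj.2⟩)
  have hϱ : IsLPSProfile ϱ := fun n k => ⟨fun s => (hA ⟨n, s⟩ k).1, by
    simp only [ϱ]
    rw [Finset.sum_comm]
    simp_rw [← Finset.sum_mul]
    rw [Finset.sum_eq_single 0]
    · rw [hcsum n 0 (Nat.zero_le _)]; simp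
    · intro j hj hj0
      rw [hcsum n j (by rw [Finset.mem_range] at hj; omega), if_neg hj0, zero_mul]
    · simp⟩
  refine ⟨ϱ, hϱ, fun n s => ⟨⟨q, by omega⟩, (hpos n s _ le_rfl).ne'⟩, ?_, fun n => ?_,
    fun n k hk => ?_⟩
  · exact Finset.sup_le fun n _ =>
      Nat.sInf_le fun s => ⟨⟨q, by omega⟩, le_rfl, (hpos n s _ le_rfl).ne'⟩
  · funext s
    simp [ϱ, hzero]
  rw [lpsBestReply_iff G hϱ hN σ n hk]
  intro s
  refine LexNonneg.mono ?_ hk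
  set y := π * algebraMap ℝ 𝕂 θ⁻¹ with hy
  have hθ' : algebraMap ℝ 𝕂 θ⁻¹ * algebraMap ℝ 𝕂 θ = 1 := by
    rw [← map_mul, inv_mul_cancel₀ hθ.ne', map_one]
  have hθpos : ∀ {c : ℝ}, 0 < c → 0 < algebraMap ℝ 𝕂 c := fun {c} hc => by
    rw [← map_zero (algebraMap ℝ 𝕂)]
    exact (realHom 𝕂).monotone'.strictMono_of_injective (algebraMap ℝ 𝕂).injective hc
  have hy0 : 0 < y := mul_pos hπ (hθpos (inv_pos.2 hθ))
  have hyv : 0 < mk y := mk_mul_pos hπv (hreal _)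
  set u := ∏ _m ∈ Finset.univ.erase n, (1 - y) with hu
  have hy1 : 0 < 1 - y := by
    have := lt_of_stdPart_lt (realHom 𝕂) (x := y) (r := 1) hyv.le
      (by rw [stdPart_eq_zero.2 hyv.ne']; exact one_pos)
    rw [map_one] at this
    exact sub_pos.2 this
  have hu0 : 0 < u := Finset.prod_pos fun _ _ => hy1
  have hmk1 : mk (1 - y) = 0 := by
    by_contra h
    have h1 := stdPart_eq_zero.2 h
    rw [stdPart_sub_eq_left hyv, stdPart_one] at h1
    exact one_ne_zero h1
  have huv : u⁻¹ ∈ finiteElements 𝕂 := by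
    refine mem_finiteElements_of_eq_zero ?_
    rw [mk_inv, hu, Finset.prod_const, mk_pow, hmk1]
    simp
  have hη : ∀ p : Σ n, S n, (1 - y) * Polynomial.aeval y (lpsPoly ϱ p.1 p.2) =
      z p + π ^ (K + 1) *
        -(r p + algebraMap ℝ 𝕂 (ϱ p.1 (Fin.last K) p.2) * algebraMap ℝ 𝕂 θ⁻¹ ^ (K + 1)) := by
    intro p
    have h1 : Polynomial.aeval y (lpsPoly ϱ p.1 p.2) = ∑ k ∈ Finset.range (K + 1),
        (∑ j ∈ Finset.range (k + 1), algebraMap ℝ 𝕂 ((P p).coeff j * θ ^ j)) * y ^ k := by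
      rw [← Fin.sum_univ_eq_sum_range (fun k =>
        (∑ j ∈ Finset.range (k + 1), algebraMap ℝ 𝕂 ((P p).coeff j * θ ^ j)) * y ^ k), lpsPoly,
        map_sum]
      refine Finset.sum_congr rfl fun k _ => ?_
      rw [map_mul, map_pow, Polynomial.aeval_C, Polynomial.aeval_X, ← map_sum]
    have h2 : ∑ j ∈ Finset.range (K + 1), algebraMap ℝ 𝕂 ((P p).coeff j * θ ^ j) * y ^ j =
        Polynomial.aeval π (P p) := by
      rw [Polynomial.aeval_eq_sum_range' (n := K + 1) (Nat.lt_succ_iff.2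
        (Polynomial.natDegree_le_iff_coeff_eq_zero.2 fun j hj => hPK p j hj))]
      refine Finset.sum_congr rfl fun j _ => ?_
      rw [Algebra.smul_def, map_mul, map_pow, hy, mul_pow]
      have : algebraMap ℝ 𝕂 θ⁻¹ ^ j * algebraMap ℝ 𝕂 θ ^ j = 1 := by
        rw [← mul_pow, hθ', one_pow]
      linear_combination algebraMap ℝ 𝕂 ((P p).coeff j) * π ^ j * this
    rw [h1, one_sub_mul_sum_partialSum, h2, ← map_sum, hP p, hy, mul_pow]
    simp only [ϱ, Fin.val_last]
    ring
  obtain ⟨t, ht, hpert⟩ := exists_aeval_add_mul (h := π ^ (K + 1)) hzfin (r := fun p : Σ n, S n =>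
    -(r p + algebraMap ℝ 𝕂 (ϱ p.1 (Fin.last K) p.2) * algebraMap ℝ 𝕂 θ⁻¹ ^ (K + 1)))
    (fun p => neg_mem (add_mem (hr p) (mul_mem (hreal _) (pow_mem (hreal _) _))))
    (pow_mem hπf _) (gainPoly G σ n s)
  simp_rw [← hη] at hpert
  rw [aeval_gainPoly_scale G σ n s (fun p => Polynomial.aeval y (lpsPoly ϱ p.1 p.2))
    (fun _ => 1 - y), ← hu] at hpert
  refine lexNonneg_of_nonneg hy0 hyv (r := -(u⁻¹ * (algebraMap ℝ 𝕂 θ ^ (K + 1) * t)))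
    (neg_mem (mul_mem huv (mul_mem (pow_mem (hreal _) _) ht))) ?_
  have hcomp : Polynomial.aeval y (MvPolynomial.aeval (fun p : Σ n, S n => lpsPoly ϱ p.1 p.2)
      (gainPoly G σ n s)) = MvPolynomial.aeval (fun p : Σ n, S n =>
        Polynomial.aeval y (lpsPoly ϱ p.1 p.2)) (gainPoly G σ n s) :=
    MvPolynomial.comp_aeval_apply _ _ _
  have hyK : y ^ (K + 1) * algebraMap ℝ 𝕂 θ ^ (K + 1) = π ^ (K + 1) := by
    rw [hy, ← mul_pow, mul_assoc, hθ', mul_one]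
  have hfin : Polynomial.aeval y (MvPolynomial.aeval (fun p : Σ n, S n => lpsPoly ϱ p.1 p.2)
      (gainPoly G σ n s)) + y ^ (K + 1) * -(u⁻¹ * (algebraMap ℝ 𝕂 θ ^ (K + 1) * t)) =
      u⁻¹ * MvPolynomial.aeval z (gainPoly G σ n s) := by
    rw [hcomp, eq_inv_mul_iff_mul_eq₀ hu0.ne']
    have := mul_inv_cancel₀ hu0.ne'
    linear_combination hpert - t * hyK - t * y ^ (K + 1) * algebraMap ℝ 𝕂 θ ^ (K + 1) * this
  rw [hfin]
  exact mul_nonneg (inv_nonneg.2 hu0.le) (hgain n s)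

end Construction

section Germs

open ArchimedeanClass

variable {𝕂 : Type*} [Field 𝕂] [LinearOrder 𝕂] [IsStrictOrderedRing 𝕂]

theorem mk_add_pos {a b : 𝕂} (ha : 0 < mk a) (hb : 0 < mk b) : 0 < mk (a + b) :=
  (lt_min ha hb).trans_le (min_le_mk_add a b)

theorem mk_sum_pos {J : Type*} (s : Finset J) {f : J → 𝕂} (h : ∀ j ∈ s, 0 < mk (f j)) :
    0 < mk (∑ j ∈ s, f j) :=
  Finset.sum_induction f (fun a => 0 < mk a) (fun _ _ => mk_add_pos)
    (lt_of_le_of_ne ((mk_zero (M := 𝕂)).symm ▸ le_top) fun h0 => by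
      rw [← mk_one, eq_comm, mk_zero, eq_comm, mk_eq_top_iff] at h0
      exact one_ne_zero h0) h

variable [Algebra ℝ 𝕂]
variable {S : Fin N → Type} [∀ n, Fintype (S n)] [∀ n, DecidableEq (S n)]

theorem exists_lps_of_hasRelations (hN : 2 ≤ N) (G : Fin N → (∀ m, S m) → ℝ) {σ : Profile S}
    (hσ : IsMixed σ) {x : Option (Σ n, S n) → 𝕂} {n₀ K : ℕ} (hrel : HasRelations x n₀) (hK : n₀ ≤ K)
    (hε0 : 0 < x none) (hε : 0 < mk (x none)) (hx : ∀ p, x none ≤ x (some p))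
    (hxσ : ∀ p, 0 < mk (x (some p) - algebraMap ℝ 𝕂 (σ p.1 p.2)))
    (hgain : ∀ n s, 0 ≤ MvPolynomial.aeval (fun p => x (some p)) (gainPoly G σ n s)) :
    ∃ ϱ : ∀ n, Fin (K + 1) → S n → ℝ, IsLPSProfile ϱ ∧ FullSupport ϱ ∧ lpsLevel ϱ ≤ n₀ ∧
      (∀ n, ϱ n 0 = σ n) ∧ ∀ n, ∀ k ≤ K, lpsBestReply G ϱ n (σ n) k := by
  obtain ⟨π, hπF, hπ, hπv, ⟨q, hq, hqπ⟩, hgen⟩ := hrel.exists_uniformizer hε hε0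
  set F := IntermediateField.adjoin ℝ (Set.range x)
  have hxF : ∀ o, x o ∈ F := fun o => IntermediateField.subset_adjoin _ _ ⟨o, rfl⟩
  have hx0 : ∀ p, 0 < x (some p) := fun p => hε0.trans_le (hx p)
  set w : Fin N → 𝕂 := fun n => ∑ s, x (some ⟨n, s⟩) with hw
  have hw1 : ∀ n, 0 < mk (w n - 1) := by
    intro n
    have : w n - 1 = ∑ s, (x (some ⟨n, s⟩) - algebraMap ℝ 𝕂 (σ n s)) := by
      rw [Finset.sum_sub_distrib, ← map_sum, (hσ n).2, map_one]
    rw [this]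
    exact mk_sum_pos _ fun s _ => hxσ ⟨n, s⟩
  have hst : ∀ n, stdPart (w n) = 1 := fun n => by
    have := stdPart_add_eq_right (y := 1) (hw1 n)
    rwa [sub_add_cancel, stdPart_one] at this
  have hwv : ∀ n, mk (w n) = 0 := fun n => by
    by_contra h
    have := hst n
    rw [stdPart_eq_zero.2 h] at this
    exact zero_ne_one this
  have hw0 : ∀ n, w n ≠ 0 := fun n h => by
    have := hst n
    rw [h, stdPart_zero] at this
    exact zero_ne_one this
  have hwpos : ∀ n, 0 < w n := fun n =>
    lt_of_le_of_ne (Finset.sum_nonneg fun s _ => (hx0 _).le) (hw0 n).symm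
  have hwi : ∀ n, mk (w n)⁻¹ = 0 := fun n => by rw [mk_inv, hwv, neg_zero]
  obtain ⟨ϱ, h1, h2, h3, h4⟩ := exists_lps_of_normalized_germ hN G σ hπF hπ hπv hgen
    (hq.trans hK) (z := fun p => (w p.1)⁻¹ * x (some p))
    (fun p => mul_mem (inv_mem (sum_mem fun s _ => hxF _)) (hxF _))
    (fun p => mul_pos (inv_pos.2 (hwpos _)) (hx0 p))
    (fun p => by
      rw [mk_mul_of_mk_eq_zero (hwi _), ← mk_mul_of_mk_eq_zero (y := π ^ q) hqπ,
        div_mul_cancel₀ _ (pow_ne_zero _ hπ.ne')]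
      exact mk_antitoneOn hε0.le (hx0 p).le (hx p))
    (fun n => (Finset.mul_sum _ _ _).symm.trans (inv_mul_cancel₀ (hw0 n)))
    (fun p => by
      have : (w p.1)⁻¹ * x (some p) - algebraMap ℝ 𝕂 (σ p.1 p.2) = (w p.1)⁻¹ *
          ((x (some p) - algebraMap ℝ 𝕂 (σ p.1 p.2)) +
            (w p.1 - 1) * algebraMap ℝ 𝕂 (-σ p.1 p.2)) := by
        have := hw0 p.1
        rw [map_neg]
        field_simp
        ring
      rw [this, mk_mul_of_mk_eq_zero (hwi _)]
      exact mk_add_pos (hxσ p) (mk_mul_pos (hw1 _) (Subalgebra.algebraMap_mem _ _)))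
    (fun n s => by
      rw [aeval_gainPoly_scale G σ n s (fun p => x (some p)) (fun m => (w m)⁻¹)]
      exact mul_nonneg (Finset.prod_nonneg fun m _ => inv_nonneg.2 (hwpos m).le) (hgain n s))
  exact ⟨ϱ, h1, h2, h3.trans hq, h4⟩

end Germs

section Hyperreals

open ArchimedeanClass Topology
open Filter (Tendsto atTop hyperfilter)
open Hyperreal (ofSeq)

/-- The hyperreals as a real algebra. -/
noncomputable instance hyperrealAlgebra : Algebra ℝ Hyperreal :=
  Hyperreal.coeRingHom.toRingHom.toAlgebra

theorem aeval_ofSeq {ι : Type*} (f : ι → ℕ → ℝ) (P : MvPolynomial ι ℝ) :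
    MvPolynomial.aeval (fun p => ofSeq (f p)) P =
      ofSeq fun k => MvPolynomial.eval (fun p => f p k) P := by
  induction P using MvPolynomial.induction_on with
  | C a => rw [MvPolynomial.aeval_C]; simp only [MvPolynomial.eval_C]; rfl
  | add p q hp hq => rw [map_add, hp, hq]; simp only [map_add]; rfl
  | mul_X p i hp =>
    rw [map_mul, hp, MvPolynomial.aeval_X]; simp only [map_mul, MvPolynomial.eval_X]; rfl

variable {S : Fin N → Type} [∀ n, Fintype (S n)] [∀ n, DecidableEq (S n)]

theorem exists_lps_of_isPerfect (hN : 2 ≤ N) {G : Fin N → (∀ m, S m) → ℝ} {σ : Profile S}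
    (hσ : IsMixed σ) (h : IsPerfect G σ) {K : ℕ}
    (hK : (2 * (N - 1) + 1) ^ Fintype.card (Σ n, S n) ≤ K) :
    ∃ ϱ : ∀ n, Fin (K + 1) → S n → ℝ, IsLPSProfile ϱ ∧ FullSupport ϱ ∧
      lpsLevel ϱ ≤ (2 * (N - 1) + 1) ^ Fintype.card (Σ n, S n) ∧
      (∀ n, ϱ n 0 = σ n) ∧ ∀ n, ∀ k ≤ K, lpsBestReply G ϱ n (σ n) k := by
  obtain ⟨τ, hτ, hlim, hbr⟩ := h
  have hex : ∀ k : ℕ, ∃ ε : ℝ, 0 < ε ∧ ε ≤ 1 / ((k : ℝ) + 1) ∧ ∀ p : Σ n, S n, ε ≤ τ k p.1 p.2 := by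
    intro k
    obtain ⟨ε, hε, hle⟩ := exists_pos_le (fun p : Σ n, S n => τ k p.1 p.2)
      fun p => (hτ k).2 p.1 p.2
    exact ⟨min ε (1 / ((k : ℝ) + 1)), lt_min hε (by positivity), min_le_right _ _,
      fun p => (min_le_left _ _).trans (hle p)⟩
  choose ε hε hε1 hετ using hex
  obtain ⟨z, b, hmin, hdist, -, hrel⟩ := exists_algebraic_minimizers (gameConstraint G σ 1)
    (fun p : Σ n, S n => σ p.1 p.2) (d := N - 1) (by omega)
    (totalDegree_gameConstraint_le G σ hN 1) (fun ε M => gameConstraint_coercive G σ 1 ε M)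
  obtain ⟨B, hB⟩ := exists_ultraconstant (hyperfilter ℕ) fun k => b (ε k)
  have hτf : ∀ k, penalty (gameConstraint G σ 1) (ε k) (fun p => τ k p.1 p.2) = 0 := by
    intro k
    refine penalty_gameConstraint_eq_zero_iff.2 ⟨fun p => ?_, hετ k, fun p => ?_⟩
    · rw [eval_gainPoly]
      exact sub_nonneg.2 (hbr k p.1 p.2)
    · have hle1 : ∀ {ρ : Profile S}, IsMixed ρ → ρ p.1 p.2 ≤ 1 := fun {ρ} hρ => by
        rw [← (hρ p.1).2]
        exact Finset.single_le_sum (fun s _ => (hρ p.1).1 s) (Finset.mem_univ _)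
      rw [abs_le]
      constructor <;> linarith [(hσ p.1).1 p.2, ((hτ k).1 p.1).1 p.2, hle1 hσ, hle1 (hτ k).1]
  have hzf : ∀ k, penalty (gameConstraint G σ 1) (ε k) (z (ε k)) = 0 := fun k =>
    le_antisymm ((hmin _ _).trans (hτf k).le) (penalty_nonneg _ _ _)
  have hz := fun k => penalty_gameConstraint_eq_zero_iff.1 (hzf k)
  have hU : (hyperfilter ℕ : Filter ℕ) ≤ atTop := Nat.hyperfilter_le_atTop
  have hε0 : Tendsto ε atTop (𝓝 0) :=
    squeeze_zero (fun k => (hε k).le) hε1 tendsto_one_div_add_atTop_nhds_zero_nat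
  have hτσ : ∀ p : Σ n, S n, Tendsto (fun k => τ k p.1 p.2) atTop (𝓝 (σ p.1 p.2)) := fun p =>
    tendsto_pi_nhds.1 (tendsto_pi_nhds.1 hlim p.1) p.2
  have hsq : Tendsto (fun k => ∑ p : Σ n, S n, (τ k p.1 p.2 - σ p.1 p.2) ^ 2) atTop (𝓝 0) := by
    have := tendsto_finsetSum (Finset.univ : Finset (Σ n, S n)) fun p _ =>
      ((hτσ p).sub_const (σ p.1 p.2)).pow 2
    simpa using this
  have hzσ : ∀ p : Σ n, S n, Tendsto (fun k => z (ε k) p - σ p.1 p.2) atTop (𝓝 0) := by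
    intro p
    have h1 : Tendsto (fun k => (z (ε k) p - σ p.1 p.2) ^ 2) atTop (𝓝 0) := by
      refine squeeze_zero (fun k => sq_nonneg _) (fun k => ?_) hsq
      exact (Finset.single_le_sum (f := fun p : Σ n, S n => (z (ε k) p - σ p.1 p.2) ^ 2)
        (fun _ _ => sq_nonneg _) (Finset.mem_univ p)).trans (hdist _ _ (hτf k))
    have h2 := h1.sqrt
    simp only [Real.sqrt_sq_eq_abs, Real.sqrt_zero] at h2
    exact (tendsto_zero_iff_abs_tendsto_zero _).2 h2
  refine exists_lps_of_hasRelations hN G hσ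
    (x := fun o => ofSeq fun k => paramPoint (ε k) (z (ε k)) o) ?_ hK ?_ ?_ ?_ ?_ ?_
  · intro m J _ g hg hJ
    obtain ⟨a, ha, hzero⟩ := hrel B m J g hg hJ
    refine ⟨a, ha, ?_⟩
    simp_rw [← map_smul]
    rw [← map_sum, aeval_ofSeq]
    refine (Filter.Germ.coe_eq.2 ?_ : ofSeq _ = ofSeq fun _ => 0)
    filter_upwards [hB] with k hk
    rw [map_sum, ← hzero _ hk]
    exact Finset.sum_congr rfl fun j _ => by rw [MvPolynomial.smul_eval]
  · exact Hyperreal.ofSeq_lt_ofSeq.2 (.of_forall hε)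
  · exact Hyperreal.archimedeanClassMk_pos_of_tendsto
      (Hyperreal.tendsto_ofSeq.2 (hε0.mono_left hU))
  · exact fun p => Hyperreal.ofSeq_le_ofSeq.2 (.of_forall fun k => (hz k).2.1 p)
  · exact fun p => Hyperreal.archimedeanClassMk_pos_of_tendsto
      (Hyperreal.tendsto_ofSeq.2 ((hzσ p).mono_left hU))
  · intro n s
    rw [aeval_ofSeq]
    exact Hyperreal.ofSeq_le_ofSeq.2 (.of_forall fun k => (hz k).1 ⟨n, s⟩)

end Hyperreals

theorem pow_le_bound_level {d κ Z D ℓ : ℕ} (hd : 1 ≤ d) (hκ : 2 ≤ κ)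
    (hZ : Z = (2*d+6)*(2*d+5)^(κ-1)) (hD : D = 5*(κ*(2*d+4)+2)*Z)
    (hℓ : ℓ = 2*d*(Z*D)^2*(1+Z)) : (2 * d + 1) ^ κ ≤ ℓ := by
  have h1 : (2 * d + 1) ^ κ ≤ Z := by
    rw [hZ, ← Nat.sub_add_cancel (by omega : 1 ≤ κ), pow_succ', Nat.add_sub_cancel]
    gcongr <;> omega
  have hZ0 : 0 < Z := (by positivity : 0 < (2 * d + 1) ^ κ).trans_le h1
  have hD0 : 0 < D := by rw [hD]; positivity
  have h2 : 0 < 2 * d * (Z * D) ^ 2 := by positivity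
  rw [hℓ]
  nlinarith

theorem mul_two_mul_pow_sub_one_le {d κ : ℕ} (hd : 1 ≤ d) (hκ : 2 ≤ κ) :
    d * (2 * (2 * d + 1) ^ κ - 1) ≤ d * (6 * d - 3) ^ (2 * κ - 1) := by
  refine Nat.mul_le_mul_left d ?_
  have h1 : (2 * d + 1) ^ κ ≤ (6 * d - 3) ^ κ := Nat.pow_le_pow_left (by omega) κ
  have h2 : (6 * d - 3) ^ (κ + 1) ≤ (6 * d - 3) ^ (2 * κ - 1) :=
    Nat.pow_le_pow_right (by omega) (by omega)
  rw [pow_succ] at h2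
  have h3 : (6 * d - 3) ^ κ * 3 ≤ (6 * d - 3) ^ κ * (6 * d - 3) :=
    Nat.mul_le_mul_left _ (by omega)
  omega

/-- with K = ℒ·ℓ it suffices that σₙ be a best reply of order ℓ(ϱ)·ℒ against ϱ. -/
theorem stmt2 {N : ℕ} (hN : 2 ≤ N) (S : Fin N → Type) [∀ n, Fintype (S n)]
    [∀ n, DecidableEq (S n)] [∀ n, Nonempty (S n)]
    (G : Fin N → (∀ m, S m) → ℝ)
    (κ d Z D L : ℕ)
    (hκ : κ = ∑ n, Fintype.card (S n)) (hd : d = N - 1)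
    (hZ : Z = (2*d+6)*(2*d+5)^(κ-1)) (hD : D = 5*(κ*(2*d+4)+2)*Z)
    (hL : L = d*(6*d-3)^(2*κ-1))
    (ℓ K : ℕ) (hℓ : ℓ = 2*d*(Z*D)^2*(1+Z)) (hK : K = L*ℓ)
    (σ : Profile S) (hσ : IsMixed σ) :
    IsPerfect G σ ↔
      ∃ ϱ : ∀ n, Fin (K+1) → S n → ℝ,
        (IsLPSProfile ϱ ∧ FullSupport ϱ ∧ lpsLevel ϱ ≤ ℓ) ∧
        (∀ n, ϱ n 0 = σ n) ∧
        (∀ n, lpsBestReply G ϱ n (σ n) (lpsLevel ϱ * L)) := by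
  have hcard : Fintype.card (Σ n, S n) = κ := by rw [hκ, Fintype.card_sigma]
  have hκ2 : 2 ≤ κ := by
    have : ∑ _n : Fin N, 1 ≤ ∑ n, Fintype.card (S n) :=
      Finset.sum_le_sum fun n _ => Fintype.card_pos
    rw [Finset.sum_const, Finset.card_univ, Fintype.card_fin, smul_eq_mul, mul_one] at this
    omega
  have hd1 : 1 ≤ d := by omega
  have hnℓ := pow_le_bound_level hd1 hκ2 hZ hD hℓ
  have hL1 := mul_two_mul_pow_sub_one_le hd1 hκ2
  rw [← hL] at hL1
  constructor
  · intro h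
    have hL0 : 0 < L := by
      rw [hL]
      exact Nat.mul_pos hd1 (pow_pos (by omega) _)
    obtain ⟨ϱ, h1, h2, h3, h4, h5⟩ := exists_lps_of_isPerfect hN hσ h (K := K) (by
      rw [hcard, ← hd, hK]
      exact hnℓ.trans (Nat.le_mul_of_pos_left ℓ hL0))
    rw [hcard, ← hd] at h3
    refine ⟨ϱ, ⟨h1, h2, h3.trans hnℓ⟩, h4, fun n => h5 n _ ?_⟩
    exact (Nat.mul_le_mul_right L (h3.trans hnℓ)).trans_eq ((mul_comm _ _).trans hK.symm)
  · rintro ⟨ϱ, ⟨h1, h2, h3⟩, h4, h5⟩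
    exact isPerfect_of_lps hN hσ h1 h2 h4 (by rw [hcard, ← hd]; exact hL1)
      ((Nat.mul_le_mul_right L h3).trans_eq ((mul_comm _ _).trans hK.symm)) h5

end GamePE
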